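/- arXiv:math/0702665 — 3 statements merged into one kernel-verified Lean document; each statement's English description precedes it below -/
import Mathlib

section
/- Fix d ≥ 1, 0 < δ₀ < 1/2, μ ∈ (2δ₀, 1), c̄ > 0, t₀ > 0, h₀ ∈ (0,1], m ∈ ℝ and a compact set Γ̄₀ ⊂ ℝ^{2d}. Let (p̂_h)_{h∈(0,h₀]} be a family of real-valued C^∞ functions on ℝ^{2d} such that for every multi-index α with |α| ≥ 1 there is C_α with sup_{ℝ^{2d}} |∂^α p̂_h| ≤ C_α h^{−δ₀·max(0,|α|−2)} for all h. Let (b_h)_{h∈(0,h₀]} be a family of C^∞ functions ℝ^{2d} → ℂ with supp b_h ⊂ Γ̄₀, with |∇p̂_h(v)| ≥ c̄ h^{δ₀} for every v ∈ supp b_h, and with |∂^α b_h(v)| ≤ C_α h^{−m−|α|δ₀} for every multi-index α and all v, h. Then for every N ∈ ℕ there exists C_N such that for all h ∈ (0,h₀] and all t ∈ ℝ with h^{1−μ} ≤ |t| ≤ t₀ one has |∫_{ℝ^{2d}} e^{i t p̂_h(v)/h} b_h(v) dv| ≤ C_N h^N. -/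
open MeasureTheory

noncomputable section

/-- The phase space `ℝ^{2d} = ℝ^d_x × ℝ^d_ξ`, with `Sum.inl` the `x`-coordinates and
`Sum.inr` the `ξ`-coordinates. -/
abbrev E2 (d : ℕ) := EuclideanSpace ℝ (Fin d ⊕ Fin d)

/-- Partial derivative in the `j`-th coordinate direction. -/
noncomputable def pd {ι : Type*} [Fintype ι] [DecidableEq ι] {F : Type*}
    [NormedAddCommGroup F] [NormedSpace ℝ F]
    (j : ι) (f : EuclideanSpace ℝ ι → F) : EuclideanSpace ℝ ι → F :=
  fun x => fderiv ℝ f x (EuclideanSpace.single j 1)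

/-- Iterated partial derivative `∂^α` associated with the multi-index `α`. -/
noncomputable def mpd {ι : Type*} [Fintype ι] [DecidableEq ι] {F : Type*}
    [NormedAddCommGroup F] [NormedSpace ℝ F]
    (α : ι → ℕ) (f : EuclideanSpace ℝ ι → F) : EuclideanSpace ℝ ι → F :=
  (Finset.univ : Finset ι).toList.foldr (fun j T => (pd j)^[α j] ∘ T) id f

/-- The length `|α|` of a multi-index. -/
def mdeg {ι : Type*} [Fintype ι] (α : ι → ℕ) : ℕ := ∑ j, α j

section PhaseAux

variable {ι : Type*} [Fintype ι] [DecidableEq ι]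
variable {F : Type*} [NormedAddCommGroup F] [NormedSpace ℝ F]

lemma pd_smooth (j : ι) {f : EuclideanSpace ℝ ι → F} (hf : ContDiff ℝ (⊤ : ℕ∞) f) :
    ContDiff ℝ (⊤ : ℕ∞) (pd j f) := by
  have h := hf.fderiv_right (m := (⊤ : ℕ∞)) (by exact_mod_cast le_refl _)
  exact h.clm_apply contDiff_const

lemma pd_smoothOn (j : ι) {f : EuclideanSpace ℝ ι → F} {U : Set (EuclideanSpace ℝ ι)}
    (hU : IsOpen U) (hf : ContDiffOn ℝ (⊤ : ℕ∞) f U) :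
    ContDiffOn ℝ (⊤ : ℕ∞) (pd j f) U := by
  have h := hf.fderiv_of_isOpen (m := (⊤ : ℕ∞)) hU (by exact_mod_cast le_refl _)
  exact h.clm_apply contDiffOn_const

lemma pd_comm (j k : ι) {f : EuclideanSpace ℝ ι → F} (hf : ContDiff ℝ (⊤ : ℕ∞) f) :
    pd j (pd k f) = pd k (pd j f) := by
  have h := hf.fderiv_right (m := (⊤ : ℕ∞)) (by exact_mod_cast le_refl _)
  have hd : Differentiable ℝ (fderiv ℝ f) := h.differentiable (by simp)
  have key : ∀ (a b : ι) x, pd a (pd b f) x =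
      fderiv ℝ (fderiv ℝ f) x (EuclideanSpace.single a 1) (EuclideanSpace.single b 1) := by
    intro a b x
    unfold pd
    rw [fderiv_clm_apply (hd x) (differentiableAt_const _)]
    simp
  ext x
  rw [key, key]
  have hs : IsSymmSndFDerivAt ℝ f x := hf.contDiffAt.isSymmSndFDerivAt (by
    simp [minSmoothness_of_isRCLikeNormedField]
    exact WithTop.coe_le_coe.2 (le_top : (2 : ℕ∞) ≤ ⊤))
  exact hs _ _

lemma pd_iter_smooth (j : ι) (n : ℕ) {f : EuclideanSpace ℝ ι → F}
    (hf : ContDiff ℝ (⊤ : ℕ∞) f) : ContDiff ℝ (⊤ : ℕ∞) ((pd j)^[n] f) := by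
  induction n generalizing f with
  | zero => simpa using hf
  | succ n ih => rw [Function.iterate_succ_apply]; exact ih (pd_smooth j hf)

lemma pd_iter_comm (j k : ι) (n : ℕ) {f : EuclideanSpace ℝ ι → F}
    (hf : ContDiff ℝ (⊤ : ℕ∞) f) : (pd k)^[n] (pd j f) = pd j ((pd k)^[n] f) := by
  induction n generalizing f with
  | zero => rfl
  | succ n ih =>
    rw [Function.iterate_succ_apply, Function.iterate_succ_apply, pd_comm k j hf,
      ih (pd_smooth k hf)]

/-- The partial iterated derivative along a list of coordinates. -/
def mpdL (L : List ι) (α : ι → ℕ) (f : EuclideanSpace ℝ ι → F) : EuclideanSpace ℝ ι → F :=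
  L.foldr (fun j T => (pd j)^[α j] ∘ T) id f

lemma mpdL_nil (α : ι → ℕ) (f : EuclideanSpace ℝ ι → F) : mpdL [] α f = f := rfl

lemma mpdL_cons (k : ι) (L : List ι) (α : ι → ℕ) (f : EuclideanSpace ℝ ι → F) :
    mpdL (k :: L) α f = (pd k)^[α k] (mpdL L α f) := rfl

lemma mpdL_smooth (L : List ι) (α : ι → ℕ) {f : EuclideanSpace ℝ ι → F}
    (hf : ContDiff ℝ (⊤ : ℕ∞) f) : ContDiff ℝ (⊤ : ℕ∞) (mpdL L α f) := by
  induction L with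
  | nil => exact hf
  | cons k L ih => rw [mpdL_cons]; exact pd_iter_smooth k _ ih

lemma mpdL_pd (L : List ι) (α : ι → ℕ) (j : ι) {f : EuclideanSpace ℝ ι → F}
    (hf : ContDiff ℝ (⊤ : ℕ∞) f) : mpdL L α (pd j f) = pd j (mpdL L α f) := by
  induction L with
  | nil => rfl
  | cons k L ih => rw [mpdL_cons, mpdL_cons, ih, pd_iter_comm _ _ _ (mpdL_smooth L α hf)]

lemma mpdL_not_mem (L : List ι) (α : ι → ℕ) (j : ι) (hj : j ∉ L)
    (f : EuclideanSpace ℝ ι → F) : mpdL L (α + Pi.single j 1) f = mpdL L α f := by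
  induction L with
  | nil => rfl
  | cons k L ih =>
    simp only [List.mem_cons, not_or] at hj
    rw [mpdL_cons, mpdL_cons, ih hj.2]
    have : (α + Pi.single j 1 : ι → ℕ) k = α k := by
      simp [Pi.single_apply, Ne.symm hj.1]
    rw [this]

lemma mpdL_mem (L : List ι) (hL : L.Nodup) (α : ι → ℕ) (j : ι) (hj : j ∈ L)
    {f : EuclideanSpace ℝ ι → F} (hf : ContDiff ℝ (⊤ : ℕ∞) f) :
    pd j (mpdL L α f) = mpdL L (α + Pi.single j 1) f := by
  induction L with
  | nil => simp at hj
  | cons k L ih =>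
    rw [List.nodup_cons] at hL
    rw [mpdL_cons, mpdL_cons]
    by_cases hjk : j = k
    · subst hjk
      rw [mpdL_not_mem L α j hL.1]
      have : (α + Pi.single j 1 : ι → ℕ) j = α j + 1 := by simp
      rw [this, Function.iterate_succ_apply']
    · have hj' : j ∈ L := by simpa [hjk] using hj
      have : (α + Pi.single j 1 : ι → ℕ) k = α k := by simp [Pi.single_apply, Ne.symm hjk]
      rw [this, ← pd_iter_comm _ _ _ (mpdL_smooth L α hf), ih hL.2 hj']

lemma mpd_pd (α : ι → ℕ) (j : ι) {f : EuclideanSpace ℝ ι → F}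
    (hf : ContDiff ℝ (⊤ : ℕ∞) f) : mpd α (pd j f) = mpd (α + Pi.single j 1) f := by
  change mpdL _ α (pd j f) = mpdL _ _ f
  rw [mpdL_pd _ _ _ hf, mpdL_mem _ (Finset.nodup_toList _) _ _ (by simp) hf]

/-- Iterated partial derivatives along a list of directions. -/
def pdl (l : List ι) (f : EuclideanSpace ℝ ι → F) : EuclideanSpace ℝ ι → F :=
  l.foldl (fun f j => pd j f) f

lemma mpd_zero (f : EuclideanSpace ℝ ι → F) : mpd (0 : ι → ℕ) f = f := by
  change mpdL _ 0 f = f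
  induction (Finset.univ : Finset ι).toList with
  | nil => rfl
  | cons k L ih => rw [mpdL_cons, ih]; rfl

/-- The multi-index of a list of directions. -/
def midx (l : List ι) : ι → ℕ := (l.map (fun j => Pi.single j 1)).sum

lemma mdeg_midx (l : List ι) : mdeg (midx l) = l.length := by
  induction l with
  | nil => simp [midx, mdeg]
  | cons j l ih =>
    simp only [midx, mdeg, List.map_cons, List.sum_cons, Pi.add_apply, Finset.sum_add_distrib,
      List.length_cons] at ih ⊢
    rw [ih]
    simp [add_comm]

lemma pdl_eq_mpd (l : List ι) {f : EuclideanSpace ℝ ι → F}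
    (hf : ContDiff ℝ (⊤ : ℕ∞) f) : pdl l f = mpd (midx l) f := by
  induction l generalizing f with
  | nil => simp [pdl, midx, mpd_zero]
  | cons j l ih =>
    change pdl l (pd j f) = _
    rw [ih (pd_smooth j hf), mpd_pd _ _ hf]
    simp [midx, add_comm]

/-- Symbol estimates up to order `n` with weight `w` and derivative cost `s`, on the sets `U i`. -/
def SymB {I : Type*} (U : I → Set (EuclideanSpace ℝ ι)) (s : I → ℝ) :
    ℕ → (I → EuclideanSpace ℝ ι → ℝ) → (I → EuclideanSpace ℝ ι → F) → Prop
  | 0, w, f => ∃ C : ℝ, 0 ≤ C ∧ ∀ i, ∀ v ∈ U i, ‖f i v‖ ≤ C * w i v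
  | n + 1, w, f => (∃ C : ℝ, 0 ≤ C ∧ ∀ i, ∀ v ∈ U i, ‖f i v‖ ≤ C * w i v) ∧
      ∀ j, SymB U s n (fun i v => s i * w i v) (fun i => pd j (f i))

variable {I : Type*} {U : I → Set (EuclideanSpace ℝ ι)} {s : I → ℝ}

lemma SymB.zeroth {n : ℕ} {w : I → EuclideanSpace ℝ ι → ℝ} {f : I → EuclideanSpace ℝ ι → F}
    (h : SymB U s n w f) : ∃ C : ℝ, 0 ≤ C ∧ ∀ i, ∀ v ∈ U i, ‖f i v‖ ≤ C * w i v := by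
  cases n with
  | zero => exact h
  | succ n => exact h.1

lemma SymB.pred {n : ℕ} {w : I → EuclideanSpace ℝ ι → ℝ} {f : I → EuclideanSpace ℝ ι → F}
    (h : SymB U s (n + 1) w f) : SymB U s n w f := by
  induction n generalizing w f with
  | zero => exact h.zeroth
  | succ n ih => exact ⟨h.1, fun j => ih (h.2 j)⟩

lemma SymB.congr (hU : ∀ i, IsOpen (U i)) {n : ℕ} {w : I → EuclideanSpace ℝ ι → ℝ}
    {f g : I → EuclideanSpace ℝ ι → F} (hfg : ∀ i, ∀ v ∈ U i, f i v = g i v)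
    (h : SymB U s n w f) : SymB U s n w g := by
  induction n generalizing w f g with
  | zero =>
    obtain ⟨C, hC, h⟩ := h
    exact ⟨C, hC, fun i v hv => by rw [← hfg i v hv]; exact h i v hv⟩
  | succ n ih =>
    obtain ⟨⟨C, hC, h⟩, h2⟩ := h
    refine ⟨⟨C, hC, fun i v hv => by rw [← hfg i v hv]; exact h i v hv⟩, fun j => ?_⟩
    refine ih (fun i v hv => ?_) (h2 j)
    have : f i =ᶠ[nhds v] g i := by
      filter_upwards [(hU i).mem_nhds hv] with x hx using hfg i x hx
    unfold pd
    rw [this.fderiv_eq]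

lemma SymB.mono (hs : ∀ i, 0 ≤ s i) {n : ℕ} {w w' : I → EuclideanSpace ℝ ι → ℝ}
    {f : I → EuclideanSpace ℝ ι → F} {K : ℝ} (hK : 0 ≤ K)
    (hw : ∀ i, ∀ v ∈ U i, w i v ≤ K * w' i v)
    (h : SymB U s n w f) : SymB U s n w' f := by
  have base : ∀ {w w' : I → EuclideanSpace ℝ ι → ℝ} {f : I → EuclideanSpace ℝ ι → F},
      (∀ i, ∀ v ∈ U i, w i v ≤ K * w' i v) →
      (∃ C : ℝ, 0 ≤ C ∧ ∀ i, ∀ v ∈ U i, ‖f i v‖ ≤ C * w i v) →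
      (∃ C : ℝ, 0 ≤ C ∧ ∀ i, ∀ v ∈ U i, ‖f i v‖ ≤ C * w' i v) := by
    rintro w w' f hw ⟨C, hC, h⟩
    refine ⟨C * K, by positivity, fun i v hv => (h i v hv).trans ?_⟩
    rw [mul_assoc]
    exact mul_le_mul_of_nonneg_left (hw i v hv) hC
  induction n generalizing w w' f with
  | zero => exact base hw h
  | succ n ih =>
    refine ⟨base hw h.1, fun j => ih (fun i v hv => ?_) (h.2 j)⟩
    have := mul_le_mul_of_nonneg_left (hw i v hv) (hs i)
    linarith

lemma pd_add_on (hU : ∀ i, IsOpen (U i)) {f g : I → EuclideanSpace ℝ ι → F}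
    (hf : ∀ i, ContDiffOn ℝ (⊤ : ℕ∞) (f i) (U i)) (hg : ∀ i, ContDiffOn ℝ (⊤ : ℕ∞) (g i) (U i))
    (j : ι) (i : I) (v) (hv : v ∈ U i) :
    pd j (fun x => f i x + g i x) v = pd j (f i) v + pd j (g i) v := by
  have h1 : DifferentiableAt ℝ (f i) v :=
    ((hf i).contDiffAt ((hU i).mem_nhds hv)).differentiableAt (by simp)
  have h2 : DifferentiableAt ℝ (g i) v :=
    ((hg i).contDiffAt ((hU i).mem_nhds hv)).differentiableAt (by simp)
  unfold pd
  rw [fderiv_fun_add h1 h2]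
  rfl

lemma SymB.add (hU : ∀ i, IsOpen (U i)) {n : ℕ} {w : I → EuclideanSpace ℝ ι → ℝ}
    {f g : I → EuclideanSpace ℝ ι → F}
    (hf : ∀ i, ContDiffOn ℝ (⊤ : ℕ∞) (f i) (U i)) (hg : ∀ i, ContDiffOn ℝ (⊤ : ℕ∞) (g i) (U i))
    (h1 : SymB U s n w f) (h2 : SymB U s n w g) :
    SymB U s n w (fun i v => f i v + g i v) := by
  have base : ∀ {w : I → EuclideanSpace ℝ ι → ℝ} {f g : I → EuclideanSpace ℝ ι → F},
      (∃ C : ℝ, 0 ≤ C ∧ ∀ i, ∀ v ∈ U i, ‖f i v‖ ≤ C * w i v) →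
      (∃ C : ℝ, 0 ≤ C ∧ ∀ i, ∀ v ∈ U i, ‖g i v‖ ≤ C * w i v) →
      (∃ C : ℝ, 0 ≤ C ∧ ∀ i, ∀ v ∈ U i, ‖f i v + g i v‖ ≤ C * w i v) := by
    rintro w f g ⟨C, hC, h⟩ ⟨D, hD, h'⟩
    refine ⟨C + D, by positivity, fun i v hv => (norm_add_le _ _).trans ?_⟩
    rw [add_mul]
    exact add_le_add (h i v hv) (h' i v hv)
  induction n generalizing w f g with
  | zero => exact base h1 h2
  | succ n ih =>
    refine ⟨base h1.1 h2.1, fun j => ?_⟩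
    refine SymB.congr hU (fun i v hv => (pd_add_on hU hf hg j i v hv).symm) ?_
    exact ih (fun i => pd_smoothOn j (hU i) (hf i)) (fun i => pd_smoothOn j (hU i) (hg i))
      (h1.2 j) (h2.2 j)

lemma SymB.zero {n : ℕ} {w : I → EuclideanSpace ℝ ι → ℝ} :
    SymB U s n w (fun _ _ => (0 : F)) := by
  induction n generalizing w with
  | zero => exact ⟨0, le_rfl, by simp⟩
  | succ n ih =>
    refine ⟨⟨0, le_rfl, by simp⟩, fun j => ?_⟩
    have : (fun (_ : I) => pd j (fun _ : EuclideanSpace ℝ ι => (0 : F))) = fun _ _ => 0 := by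
      ext i v; simp [pd]
    rw [this]; exact ih

lemma SymB.sum (hU : ∀ i, IsOpen (U i)) {n : ℕ} {w : I → EuclideanSpace ℝ ι → ℝ}
    {κ : Type*} (S : Finset κ) {f : κ → I → EuclideanSpace ℝ ι → F}
    (hf : ∀ k i, ContDiffOn ℝ (⊤ : ℕ∞) (f k i) (U i))
    (h : ∀ k, SymB U s n w (f k)) :
    SymB U s n w (fun i v => ∑ k ∈ S, f k i v) := by
  classical
  induction S using Finset.induction_on with
  | empty => simpa using SymB.zero
  | insert a S ha ih =>
    simp only [Finset.sum_insert ha]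
    exact SymB.add hU (hf a) (fun i => ContDiffOn.sum fun k _ => hf k i) (h a) ih

lemma pd_mul_on (hU : ∀ i, IsOpen (U i)) {f g : I → EuclideanSpace ℝ ι → ℂ}
    (hf : ∀ i, ContDiffOn ℝ (⊤ : ℕ∞) (f i) (U i)) (hg : ∀ i, ContDiffOn ℝ (⊤ : ℕ∞) (g i) (U i))
    (j : ι) (i : I) (v) (hv : v ∈ U i) :
    pd j (fun x => f i x * g i x) v = pd j (f i) v * g i v + f i v * pd j (g i) v := by
  have h1 : DifferentiableAt ℝ (f i) v :=
    ((hf i).contDiffAt ((hU i).mem_nhds hv)).differentiableAt (by simp)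
  have h2 : DifferentiableAt ℝ (g i) v :=
    ((hg i).contDiffAt ((hU i).mem_nhds hv)).differentiableAt (by simp)
  unfold pd
  rw [fderiv_fun_mul h1 h2]
  simp
  ring

lemma SymB.mul (hU : ∀ i, IsOpen (U i)) {n : ℕ}
    {w w' : I → EuclideanSpace ℝ ι → ℝ} {f g : I → EuclideanSpace ℝ ι → ℂ}
    (hf : ∀ i, ContDiffOn ℝ (⊤ : ℕ∞) (f i) (U i)) (hg : ∀ i, ContDiffOn ℝ (⊤ : ℕ∞) (g i) (U i))
    (h1 : SymB U s n w f) (h2 : SymB U s n w' g) :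
    SymB U s n (fun i v => w i v * w' i v) (fun i v => f i v * g i v) := by
  have base : ∀ {w w' : I → EuclideanSpace ℝ ι → ℝ} {f g : I → EuclideanSpace ℝ ι → ℂ},
      (∃ C : ℝ, 0 ≤ C ∧ ∀ i, ∀ v ∈ U i, ‖f i v‖ ≤ C * w i v) →
      (∃ C : ℝ, 0 ≤ C ∧ ∀ i, ∀ v ∈ U i, ‖g i v‖ ≤ C * w' i v) →
      (∃ C : ℝ, 0 ≤ C ∧ ∀ i, ∀ v ∈ U i, ‖f i v * g i v‖ ≤ C * (w i v * w' i v)) := by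
    rintro w w' f g ⟨C, hC, h⟩ ⟨D, hD, h'⟩
    refine ⟨C * D, by positivity, fun i v hv => ?_⟩
    rw [norm_mul]
    have := mul_le_mul (h i v hv) (h' i v hv) (norm_nonneg _) ((norm_nonneg _).trans (h i v hv))
    linarith
  induction n generalizing w w' f g with
  | zero => exact base h1 h2
  | succ n ih =>
    refine ⟨base h1.1 h2.1, fun j => ?_⟩
    refine SymB.congr hU (fun i v hv => (pd_mul_on hU hf hg j i v hv).symm) ?_
    have hf' := fun i => pd_smoothOn j (hU i) (hf i)
    have hg' := fun i => pd_smoothOn j (hU i) (hg i)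
    refine SymB.add hU (fun i => (hf' i).mul (hg i)) (fun i => (hf i).mul (hg' i)) ?_ ?_
    · have := ih hf' hg (h1.2 j) h2.pred
      simpa only [mul_assoc] using this
    · have := ih hf hg' h1.pred (h2.2 j)
      simpa only [mul_left_comm] using this

lemma SymB.neg {n : ℕ} {w : I → EuclideanSpace ℝ ι → ℝ} {f : I → EuclideanSpace ℝ ι → F}
    (h : SymB U s n w f) : SymB U s n w (fun i v => - f i v) := by
  induction n generalizing w f with
  | zero => simpa [SymB] using h
  | succ n ih =>
    refine ⟨by simpa using h.1, fun j => ?_⟩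
    have : (fun i => pd j (fun v => - f i v)) = fun i v => - pd j (f i) v := by
      ext i v; simp [pd]
    rw [this]
    exact ih (h.2 j)

lemma SymB.inv (hs : ∀ i, 0 ≤ s i) (hU : ∀ i, IsOpen (U i)) {n : ℕ}
    {w : I → EuclideanSpace ℝ ι → ℝ} {f : I → EuclideanSpace ℝ ι → ℂ}
    (hw : ∀ i, ∀ v ∈ U i, 0 < w i v) (hwf : ∀ i, ∀ v ∈ U i, w i v ≤ ‖f i v‖)
    (hf : ∀ i, ContDiffOn ℝ (⊤ : ℕ∞) (f i) (U i))
    (h : SymB U s n w f) : SymB U s n (fun i v => (w i v)⁻¹) (fun i v => (f i v)⁻¹) := by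
  have hne : ∀ i, ∀ v ∈ U i, f i v ≠ 0 := fun i v hv =>
    norm_pos_iff.1 ((hw i v hv).trans_le (hwf i v hv))
  have base : (∃ C : ℝ, 0 ≤ C ∧ ∀ i, ∀ v ∈ U i, ‖(f i v)⁻¹‖ ≤ C * (w i v)⁻¹) := by
    refine ⟨1, zero_le_one, fun i v hv => ?_⟩
    rw [norm_inv, one_mul]
    exact inv_anti₀ (hw i v hv) (hwf i v hv)
  have hfi : ∀ i, ContDiffOn ℝ (⊤ : ℕ∞) (fun v => (f i v)⁻¹) (U i) :=
    fun i => (hf i).inv (hne i)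
  induction n with
  | zero => exact base
  | succ n ih =>
    refine ⟨base, fun j => ?_⟩
    have ih' := ih h.pred
    have hf' := fun i => pd_smoothOn j (hU i) (hf i)
    have h3 := SymB.neg (SymB.mul hU hf' (fun i => (hfi i).mul (hfi i)) (h.2 j)
      (SymB.mul hU hfi hfi ih' ih'))
    have h4 : SymB U s n (fun i v => s i * (w i v)⁻¹)
        (fun i v => -(pd j (f i) v * ((f i v)⁻¹ * (f i v)⁻¹))) := by
      refine SymB.mono hs zero_le_one (fun i v hv => ?_) h3
      have := (hw i v hv).ne'
      apply le_of_eq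
      field_simp
    refine SymB.congr hU (fun i v hv => ?_) h4
    have h1 : DifferentiableAt ℝ (f i) v :=
      ((hf i).contDiffAt ((hU i).mem_nhds hv)).differentiableAt (by simp)
    have h2 := pd_mul_on hU hf hfi j i v hv
    have h0 : pd j (fun x => f i x * (f i x)⁻¹) v = 0 := by
      have : (fun x => f i x * (f i x)⁻¹) =ᶠ[nhds v] fun _ => (1 : ℂ) := by
        filter_upwards [(hU i).mem_nhds hv] with x hx using mul_inv_cancel₀ (hne i x hx)
      unfold pd
      rw [this.fderiv_eq]
      simp
    rw [h0] at h2
    have hn := hne i v hv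
    have h5 : f i v * (pd j (fun x => (f i x)⁻¹) v) = - (pd j (f i) v * (f i v)⁻¹) := by
      linear_combination -h2
    apply mul_left_cancel₀ hn
    rw [h5]
    field_simp

lemma SymB.of_list {w : I → EuclideanSpace ℝ ι → ℝ} {f : I → EuclideanSpace ℝ ι → F}
    (h : ∀ l : List ι, ∃ C : ℝ, ∀ i, ∀ v ∈ U i, ‖pdl l (f i) v‖ ≤ C * (s i ^ l.length * w i v))
    (hw : ∀ i, ∀ v ∈ U i, 0 ≤ w i v) (hs : ∀ i, 0 ≤ s i)
    (n : ℕ) : SymB U s n w f := by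
  have base : ∃ C : ℝ, 0 ≤ C ∧ ∀ i, ∀ v ∈ U i, ‖f i v‖ ≤ C * w i v := by
    obtain ⟨C, hC⟩ := h []
    refine ⟨|C|, abs_nonneg _, fun i v hv => ?_⟩
    have := hC i v hv
    simp only [pdl, List.foldl_nil, List.length_nil, pow_zero, one_mul] at this
    exact this.trans (mul_le_mul_of_nonneg_right (le_abs_self C) (hw i v hv))
  induction n generalizing w f with
  | zero => exact base
  | succ n ih =>
    have hw' : ∀ i, ∀ v ∈ U i, 0 ≤ s i * w i v := fun i v hv => mul_nonneg (hs i) (hw i v hv)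
    have h' : ∀ j, ∀ l : List ι, ∃ C : ℝ, ∀ i, ∀ v ∈ U i,
        ‖pdl l (pd j (f i)) v‖ ≤ C * (s i ^ l.length * (s i * w i v)) := by
      intro j l
      obtain ⟨C, hC⟩ := h (j :: l)
      refine ⟨C, fun i v hv => (hC i v hv).trans (le_of_eq ?_)⟩
      rw [List.length_cons]; ring
    refine ⟨base, fun j => ih (h' j) hw' ?_⟩
    obtain ⟨C, hC⟩ := h' j []
    refine ⟨|C|, abs_nonneg _, fun i v hv => ?_⟩
    have := hC i v hv
    simp only [pdl, List.foldl_nil, List.length_nil, pow_zero, one_mul] at this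
    exact this.trans (mul_le_mul_of_nonneg_right (le_abs_self C) (hw' i v hv))

lemma SymB.ofReal {n : ℕ} {w : I → EuclideanSpace ℝ ι → ℝ} {f : I → EuclideanSpace ℝ ι → ℝ}
    (hf : ∀ i, ContDiff ℝ (⊤ : ℕ∞) (f i))
    (h : SymB U s n w f) : SymB U s n w (fun i v => ((f i v : ℝ) : ℂ)) := by
  induction n generalizing w f with
  | zero =>
    obtain ⟨C, hC, h⟩ := h
    exact ⟨C, hC, fun i v hv => by simpa using h i v hv⟩
  | succ n ih =>
    obtain ⟨⟨C, hC, h⟩, h2⟩ := h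
    refine ⟨⟨C, hC, fun i v hv => by simpa using h i v hv⟩, fun j => ?_⟩
    have : (fun i => pd j (fun v => ((f i v : ℝ) : ℂ))) = fun i v => ((pd j (f i) v : ℝ) : ℂ) := by
      ext i v
      have h1 : HasFDerivAt (f i) (fderiv ℝ (f i) v) v :=
        ((hf i).differentiable (by simp) v).hasFDerivAt
      have h3 := (Complex.ofRealCLM.hasFDerivAt.comp v h1).fderiv
      unfold pd
      change fderiv ℝ (Complex.ofRealCLM ∘ (f i)) v _ = _
      rw [h3]
      simp
    rw [this]
    exact ih (fun i => pd_smooth j (hf i)) (h2 j)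

/-- The transposed first-order operator used in the integration by parts. -/
def ampStep (X : ι → EuclideanSpace ℝ ι → ℂ) (a : EuclideanSpace ℝ ι → ℂ) :
    EuclideanSpace ℝ ι → ℂ :=
  fun v => ∑ j, pd j (fun x => X j x * a x) v

lemma mul_smooth_of_tsupport {V : Set (EuclideanSpace ℝ ι)} (hV : IsOpen V)
    {f a : EuclideanSpace ℝ ι → ℂ} (hf : ContDiffOn ℝ (⊤ : ℕ∞) f V)
    (ha : ContDiff ℝ (⊤ : ℕ∞) a) (hs : tsupport a ⊆ V) :
    ContDiff ℝ (⊤ : ℕ∞) (fun x => f x * a x) := by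
  rw [contDiff_iff_contDiffAt]
  intro x
  by_cases hx : x ∈ tsupport a
  · exact (hf.contDiffAt (hV.mem_nhds (hs hx))).mul ha.contDiffAt
  · have : (fun x => f x * a x) =ᶠ[nhds x] fun _ => 0 := by
      have := notMem_tsupport_iff_eventuallyEq.1 hx
      filter_upwards [this] with y hy
      simp [hy]
    exact contDiffAt_const.congr_of_eventuallyEq this

lemma tsupport_mul_sub (f a : EuclideanSpace ℝ ι → ℂ) :
    tsupport (fun x => f x * a x) ⊆ tsupport a := by
  apply closure_mono
  intro x hx
  simp only [Function.mem_support] at hx ⊢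
  exact fun h => hx (by simp [h])

lemma tsupport_pd_sub (j : ι) (f : EuclideanSpace ℝ ι → F) : tsupport (pd j f) ⊆ tsupport f :=
  tsupport_fderiv_apply_subset ℝ _

lemma ampStep_smooth {V : Set (EuclideanSpace ℝ ι)} (hV : IsOpen V)
    {X : ι → EuclideanSpace ℝ ι → ℂ} {a : EuclideanSpace ℝ ι → ℂ}
    (hX : ∀ j, ContDiffOn ℝ (⊤ : ℕ∞) (X j) V)
    (ha : ContDiff ℝ (⊤ : ℕ∞) a) (hs : tsupport a ⊆ V) :
    ContDiff ℝ (⊤ : ℕ∞) (ampStep X a) :=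
  ContDiff.sum fun j _ => pd_smooth j (mul_smooth_of_tsupport hV (hX j) ha hs)

lemma ampStep_tsupport (X : ι → EuclideanSpace ℝ ι → ℂ) (a : EuclideanSpace ℝ ι → ℂ) :
    tsupport (ampStep X a) ⊆ tsupport a := by
  refine closure_minimal (fun x hx => ?_) isClosed_closure
  by_contra hxa
  apply hx
  refine Finset.sum_eq_zero fun j _ => ?_
  by_contra h
  exact hxa (tsupport_mul_sub _ _ (tsupport_pd_sub j _ (subset_closure h)))

lemma ibp {V : Set (EuclideanSpace ℝ ι)} (hV : IsOpen V)
    {X : ι → EuclideanSpace ℝ ι → ℂ} {a : EuclideanSpace ℝ ι → ℂ}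
    {φ : EuclideanSpace ℝ ι → ℝ} (hφ : ContDiff ℝ (⊤ : ℕ∞) φ) (lam : ℝ)
    (hX : ∀ j, ContDiffOn ℝ (⊤ : ℕ∞) (X j) V)
    (ha : ContDiff ℝ (⊤ : ℕ∞) a) (hs : tsupport a ⊆ V) (hc : HasCompactSupport a)
    (hX1 : ∀ v ∈ V, ∑ j, ((pd j φ v : ℝ) : ℂ) * X j v = 1) :
    (Complex.I * lam) * ∫ v, Complex.exp (Complex.I * lam * φ v) * a v
      = - ∫ v, Complex.exp (Complex.I * lam * φ v) * ampStep X a v := by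
  set e : EuclideanSpace ℝ ι → ℂ := fun v => Complex.exp (Complex.I * lam * φ v) with he
  have hes : ContDiff ℝ (⊤ : ℕ∞) e := by
    have : ContDiff ℝ (⊤ : ℕ∞) (fun v => (φ v : ℂ)) := Complex.ofRealCLM.contDiff.comp hφ
    exact (contDiff_const.mul this).cexp
  have hpe : ∀ j v, pd j e v = Complex.I * lam * ((pd j φ v : ℝ) : ℂ) * e v := by
    intro j v
    have h1 : HasFDerivAt φ (fderiv ℝ φ v) v := (hφ.differentiable (by simp) v).hasFDerivAt
    have h3 := ((Complex.ofRealCLM.hasFDerivAt.comp v h1).const_mul (Complex.I * lam)).cexp.fderiv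
    unfold pd
    change fderiv ℝ (fun v => Complex.exp (Complex.I * lam * (Complex.ofRealCLM ∘ φ) v)) v _ = _
    rw [h3]
    simp [he]
    ring
  have hg : ∀ j, ContDiff ℝ (⊤ : ℕ∞) (fun x => X j x * a x) := fun j =>
    mul_smooth_of_tsupport hV (hX j) ha hs
  have hgc : ∀ j, HasCompactSupport (fun x => X j x * a x) := fun j => hc.mul_left
  have hgc' : ∀ j, HasCompactSupport (pd j (fun x => X j x * a x)) := fun j =>
    (hgc j).of_isClosed_subset isClosed_closure (tsupport_pd_sub j _)
  have i1 : ∀ j, Integrable (fun x => pd j e x * (X j x * a x)) := fun j =>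
    ((pd_smooth j hes).continuous.mul (hg j).continuous).integrable_of_hasCompactSupport
      (hgc j).mul_left
  have i2 : ∀ j, Integrable (fun x => e x * pd j (fun x => X j x * a x) x) := fun j =>
    (hes.continuous.mul (pd_smooth j (hg j)).continuous).integrable_of_hasCompactSupport
      (hgc' j).mul_left
  have i3 : ∀ j, Integrable (fun x => e x * (X j x * a x)) := fun j =>
    (hes.continuous.mul (hg j).continuous).integrable_of_hasCompactSupport (hgc j).mul_left
  have key : ∀ j, ∫ x, e x * pd j (fun x => X j x * a x) x = - ∫ x, pd j e x * (X j x * a x) :=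
    fun j => integral_mul_fderiv_eq_neg_fderiv_mul_of_integrable (i1 j) (i2 j) (i3 j)
      (fun x _ => hes.differentiable (by simp) x) (fun x _ => (hg j).differentiable (by simp) x)
  have hR : ∫ v, e v * ampStep X a v = ∑ j, ∫ x, e x * pd j (fun x => X j x * a x) x := by
    rw [← integral_finsetSum _ (fun j _ => i2 j)]
    simp only [ampStep, Finset.mul_sum]
  rw [hR, Finset.sum_congr rfl (fun j _ => key j), Finset.sum_neg_distrib, neg_neg,
    ← integral_finsetSum _ (fun j _ => i1 j), ← integral_const_mul]
  congr 1
  ext v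
  by_cases hv : v ∈ V
  · have : ∑ j, pd j e v * (X j v * a v) =
        Complex.I * lam * e v * a v * ∑ j, ((pd j φ v : ℝ) : ℂ) * X j v := by
      rw [Finset.mul_sum]
      refine Finset.sum_congr rfl fun j _ => ?_
      rw [hpe]; ring
    rw [this, hX1 v hv]; ring
  · have : a v = 0 := by
      by_contra h
      exact hv (hs (subset_closure h))
    simp [this]

lemma ampStep_sym (hU : ∀ i, IsOpen (U i)) {w k : I → EuclideanSpace ℝ ι → ℝ}
    {X : I → ι → EuclideanSpace ℝ ι → ℂ} {a : I → EuclideanSpace ℝ ι → ℂ}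
    (hX : ∀ i j, ContDiffOn ℝ (⊤ : ℕ∞) (X i j) (U i))
    (ha : ∀ i, ContDiff ℝ (⊤ : ℕ∞) (a i))
    (hXs : ∀ j n, SymB U s n k (fun i => X i j)) (has : ∀ n, SymB U s n w a) (n : ℕ) :
    SymB U s n (fun i v => s i * (k i v * w i v)) (fun i => ampStep (X i) (a i)) := by
  have hm : ∀ j i, ContDiffOn ℝ (⊤ : ℕ∞) (fun x => X i j x * a i x) (U i) :=
    fun j i => (hX i j).mul (ha i).contDiffOn
  refine SymB.sum hU Finset.univ (f := fun j i => pd j (fun x => X i j x * a i x))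
    (fun j i => pd_smoothOn j (hU i) (hm j i)) fun j => ?_
  exact (SymB.mul hU (fun i => hX i j) (fun i => (ha i).contDiffOn) (hXs j (n+1)) (has (n+1))).2 j

lemma pd_eq_gradient (j : ι) {f : EuclideanSpace ℝ ι → ℝ} (v) : pd j f v = gradient f v j := by
  have h : inner ℝ (gradient f v) (EuclideanSpace.single j (1:ℝ)) = pd j f v := by
    unfold gradient pd
    rw [InnerProductSpace.toDual_symm_apply]
  rw [← h, EuclideanSpace.inner_single_right]
  simp

lemma gradient_sq {f : EuclideanSpace ℝ ι → ℝ} (v) :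
    ‖gradient f v‖ ^ 2 = ∑ j, pd j f v ^ 2 := by
  rw [EuclideanSpace.norm_sq_eq]
  simp [pd_eq_gradient]

lemma abs_pd_le (j : ι) {f : EuclideanSpace ℝ ι → ℝ} (v) : |pd j f v| ≤ ‖gradient f v‖ := by
  apply abs_le_of_sq_le_sq _ (norm_nonneg _)
  rw [gradient_sq]
  exact Finset.single_le_sum (f := fun j => pd j f v ^ 2) (fun _ _ => sq_nonneg _)
    (Finset.mem_univ j)

lemma continuous_norm_gradient {f : EuclideanSpace ℝ ι → ℝ} (hf : ContDiff ℝ (⊤ : ℕ∞) f) :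
    Continuous (fun v => ‖gradient f v‖) := by
  have : Continuous (gradient f) := by
    unfold gradient
    exact (LinearIsometryEquiv.continuous _).comp (hf.continuous_fderiv (by simp))
  exact this.norm

end PhaseAux

/-- Non-stationary phase estimate (proof of (4.24)/(5.2)): if `b_h` is supported where
`|∇p̂_h| ≥ c̄h^{δ₀}`, then the oscillatory integral `∫ e^{itp̂_h/h} b_h dv` is `O(h^∞)`
uniformly for `h^{1−μ} ≤ |t| ≤ t₀`. -/
theorem nonstationary_phase {d : ℕ} (hd : 1 ≤ d) {δ₀ μ cbar t₀ h₀ m : ℝ}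
    (hδ0 : 0 < δ₀) (hδ1 : δ₀ < 1/2) (hμ1 : 2 * δ₀ < μ) (hμ2 : μ < 1)
    (hcbar : 0 < cbar) (ht₀ : 0 < t₀) (hh₀ : 0 < h₀) (hh₀1 : h₀ ≤ 1)
    (Γ₀ : Set (E2 d)) (hΓ : IsCompact Γ₀)
    (p : ℝ → E2 d → ℝ)
    (hpsm : ∀ h ∈ Set.Ioc (0:ℝ) h₀, ContDiff ℝ (⊤ : ℕ∞) (p h))
    (hpi : ∀ α : (Fin d ⊕ Fin d) → ℕ, 1 ≤ mdeg α → ∃ C : ℝ,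
      ∀ h ∈ Set.Ioc (0:ℝ) h₀, ∀ v : E2 d,
        |mpd α (p h) v| ≤ C * h ^ (-δ₀ * ((mdeg α - 2 : ℕ) : ℝ)))
    (b : ℝ → E2 d → ℂ)
    (hbsm : ∀ h ∈ Set.Ioc (0:ℝ) h₀, ContDiff ℝ (⊤ : ℕ∞) (b h))
    (hbsupp : ∀ h ∈ Set.Ioc (0:ℝ) h₀, tsupport (b h) ⊆ Γ₀)
    (hgrad : ∀ h ∈ Set.Ioc (0:ℝ) h₀, ∀ v ∈ tsupport (b h),
      cbar * h ^ δ₀ ≤ ‖gradient (p h) v‖)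
    (hbder : ∀ α : (Fin d ⊕ Fin d) → ℕ, ∃ C : ℝ,
      ∀ h ∈ Set.Ioc (0:ℝ) h₀, ∀ v : E2 d,
        ‖mpd α (b h) v‖ ≤ C * h ^ (-m - (mdeg α : ℝ) * δ₀)) :
    ∀ N : ℕ, ∃ C : ℝ, ∀ h ∈ Set.Ioc (0:ℝ) h₀, ∀ t : ℝ,
      h ^ (1 - μ) ≤ |t| → |t| ≤ t₀ →
        ‖∫ v : E2 d, Complex.exp (Complex.I * t * p h v / h) * b h v‖ ≤ C * h ^ N := by
  have hsm : ∀ i : Set.Ioc (0:ℝ) h₀, ContDiff ℝ (⊤ : ℕ∞) (p i) := fun i => hpsm i i.2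
  have hbm : ∀ i : Set.Ioc (0:ℝ) h₀, ContDiff ℝ (⊤ : ℕ∞) (b i) := fun i => hbsm i i.2
  have hpos : ∀ i : Set.Ioc (0:ℝ) h₀, 0 < (i : ℝ) := fun i => i.2.1
  let s : Set.Ioc (0:ℝ) h₀ → ℝ := fun i => (i : ℝ) ^ (-δ₀)
  let g : Set.Ioc (0:ℝ) h₀ → E2 d → ℝ := fun i v => ‖gradient (p i) v‖
  let U : Set.Ioc (0:ℝ) h₀ → Set (E2 d) := fun i => {v | cbar / 2 * (i : ℝ) ^ δ₀ < g i v}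
  have hs0 : ∀ i, 0 < s i := fun i => Real.rpow_pos_of_pos (hpos i) _
  have hs : ∀ i, 0 ≤ s i := fun i => (hs0 i).le
  have hsi : ∀ i : Set.Ioc (0:ℝ) h₀, (i : ℝ) ^ δ₀ * s i = 1 := fun i => by
    change (i : ℝ) ^ δ₀ * (i : ℝ) ^ (-δ₀) = 1
    rw [← Real.rpow_add (hpos i)]; simp
  have hU : ∀ i, IsOpen (U i) := fun i =>
    isOpen_lt continuous_const (continuous_norm_gradient (hsm i))
  have hbU : ∀ i : Set.Ioc (0:ℝ) h₀, tsupport (b i) ⊆ U i := by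
    intro i v hv
    have h1 := hgrad i i.2 v hv
    have h2 : 0 < cbar * (i : ℝ) ^ δ₀ := mul_pos hcbar (Real.rpow_pos_of_pos (hpos i) _)
    change cbar / 2 * (i : ℝ) ^ δ₀ < ‖gradient (p i) v‖
    linarith
  have hg0 : ∀ i, ∀ v ∈ U i, 0 < g i v := by
    intro i v hv
    have h2 : 0 < cbar * (i : ℝ) ^ δ₀ := mul_pos hcbar (Real.rpow_pos_of_pos (hpos i) _)
    have h3 : cbar / 2 * (i : ℝ) ^ δ₀ < g i v := hv
    linarith
  have hgs : ∀ i, ∀ v ∈ U i, 1 ≤ 2 / cbar * (s i * g i v) := by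
    intro i v hv
    have h3 : cbar / 2 * (i : ℝ) ^ δ₀ < g i v := hv
    have h4 := mul_le_mul_of_nonneg_left h3.le (hs i)
    have h5 : s i * (cbar / 2 * (i : ℝ) ^ δ₀) = cbar / 2 := by
      linear_combination (cbar / 2) * hsi i
    rw [h5] at h4
    have h6 := mul_le_mul_of_nonneg_left h4 (by positivity : 0 ≤ 2 / cbar)
    have h7 : 2 / cbar * (cbar / 2) = 1 := by field_simp
    linarith
  -- symbol estimates for the first derivatives of the phase
  have hPs : ∀ j n, SymB U s n g (fun i => pd j (p i)) := by
    intro j n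
    refine SymB.of_list (fun l => ?_) (fun i v hv => (hg0 i v hv).le) hs n
    cases l with
    | nil =>
      refine ⟨1, fun i v hv => ?_⟩
      simpa [pdl] using abs_pd_le j (f := p i) v
    | cons j' l =>
      obtain ⟨C, hC⟩ := hpi (midx (j :: j' :: l)) (by rw [mdeg_midx]; simp)
      refine ⟨|C| * (2 / cbar), fun i v hv => ?_⟩
      have h1 := hC i i.2 v
      rw [← pdl_eq_mpd _ (hsm i), mdeg_midx] at h1
      have h2 : (i : ℝ) ^ (-δ₀ * (((j :: j' :: l).length - 2 : ℕ) : ℝ)) = s i ^ l.length := by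
        simp only [List.length_cons, s]
        rw [← Real.rpow_natCast, ← Real.rpow_mul (hpos i).le]
        simp
      rw [h2] at h1
      have h3 : 0 ≤ s i ^ l.length := pow_nonneg (hs i) _
      rw [Real.norm_eq_abs]
      calc |pdl (j' :: l) (pd j (p i)) v| ≤ C * s i ^ l.length := h1
        _ ≤ |C| * s i ^ l.length * 1 := by
          rw [mul_one]; exact mul_le_mul_of_nonneg_right (le_abs_self C) h3
        _ ≤ |C| * s i ^ l.length * (2 / cbar * (s i * g i v)) :=
          mul_le_mul_of_nonneg_left (hgs i v hv) (by positivity)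
        _ = _ := by rw [List.length_cons]; ring
  let P : (Fin d ⊕ Fin d) → Set.Ioc (0:ℝ) h₀ → E2 d → ℂ := fun j i v => ((pd j (p i) v : ℝ) : ℂ)
  have hPm : ∀ j i, ContDiff ℝ (⊤ : ℕ∞) (P j i) := fun j i =>
    Complex.ofRealCLM.contDiff.comp (pd_smooth j (hsm i))
  have hPc : ∀ j n, SymB U s n g (P j) := fun j n =>
    SymB.ofReal (fun i => pd_smooth j (hsm i)) (hPs j n)
  let Q : Set.Ioc (0:ℝ) h₀ → E2 d → ℂ := fun i v => ∑ j, P j i v * P j i v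
  have hQm : ∀ i, ContDiff ℝ (⊤ : ℕ∞) (Q i) := fun i =>
    ContDiff.sum fun j _ => (hPm j i).mul (hPm j i)
  have hQc : ∀ n, SymB U s n (fun i v => g i v * g i v) Q := fun n =>
    SymB.sum hU Finset.univ (f := fun j i v => P j i v * P j i v)
      (fun j i => ((hPm j i).mul (hPm j i)).contDiffOn)
      (fun j => SymB.mul hU (fun i => (hPm j i).contDiffOn) (fun i => (hPm j i).contDiffOn)
        (hPc j n) (hPc j n))
  have hQg : ∀ i v, Q i v = ((g i v * g i v : ℝ) : ℂ) := by
    intro i v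
    have h1 := gradient_sq (f := p i) v
    have h2 : g i v * g i v = ∑ j, pd j (p i) v * pd j (p i) v := by
      rw [← pow_two, h1]
      exact Finset.sum_congr rfl fun j _ => pow_two _
    rw [h2]
    simp [Q, P]
  have hgg : ∀ i, ∀ v ∈ U i, 0 < g i v * g i v := fun i v hv => mul_pos (hg0 i v hv) (hg0 i v hv)
  have hQle : ∀ i, ∀ v ∈ U i, g i v * g i v ≤ ‖Q i v‖ := by
    intro i v hv
    rw [hQg, Complex.norm_real, Real.norm_eq_abs]
    exact le_abs_self _
  have hQne : ∀ i, ∀ v ∈ U i, Q i v ≠ 0 := fun i v hv =>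
    norm_pos_iff.1 ((hgg i v hv).trans_le (hQle i v hv))
  have hQi : ∀ n, SymB U s n (fun i v => (g i v * g i v)⁻¹) (fun i v => (Q i v)⁻¹) := fun n =>
    SymB.inv hs hU hgg hQle (fun i => (hQm i).contDiffOn) (hQc n)
  have hQim : ∀ i, ContDiffOn ℝ (⊤ : ℕ∞) (fun v => (Q i v)⁻¹) (U i) := fun i =>
    (hQm i).contDiffOn.inv (hQne i)
  let X : Set.Ioc (0:ℝ) h₀ → (Fin d ⊕ Fin d) → E2 d → ℂ := fun i j v => P j i v * (Q i v)⁻¹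
  have hXm : ∀ i j, ContDiffOn ℝ (⊤ : ℕ∞) (X i j) (U i) := fun i j =>
    (hPm j i).contDiffOn.mul (hQim i)
  have hXc : ∀ j n, SymB U s n (fun i _ => s i) (fun i => X i j) := by
    intro j n
    refine SymB.mono hs (K := 2 / cbar) (by positivity) (fun i v hv => ?_)
      (SymB.mul hU (fun i => (hPm j i).contDiffOn) hQim (hPc j n) (hQi n))
    have h1 := hg0 i v hv
    have h2 := hgs i v hv
    have h3 : g i v * (g i v * g i v)⁻¹ = 1 / g i v := by field_simp
    rw [h3, div_le_iff₀ h1]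
    linarith
  have hX1 : ∀ i, ∀ v ∈ U i, ∑ j, ((pd j (p i) v : ℝ) : ℂ) * X i j v = 1 := by
    intro i v hv
    have : ∑ j, ((pd j (p i) v : ℝ) : ℂ) * X i j v = Q i v * (Q i v)⁻¹ := by
      simp only [Q, Finset.sum_mul]
      refine Finset.sum_congr rfl fun j _ => ?_
      simp only [X, P, Q]
      ring
    rw [this, mul_inv_cancel₀ (hQne i v hv)]
  have hbs : ∀ n, SymB U s n (fun i _ => (i : ℝ) ^ (-m)) (fun i => b i) := by
    intro n
    refine SymB.of_list (fun l => ?_) (fun i v hv => (Real.rpow_pos_of_pos (hpos i) _).le) hs n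
    obtain ⟨C, hC⟩ := hbder (midx l)
    refine ⟨C, fun i v hv => ?_⟩
    have h1 := hC i i.2 v
    rw [← pdl_eq_mpd _ (hbm i), mdeg_midx] at h1
    refine h1.trans (le_of_eq ?_)
    have h2 : (i : ℝ) ^ (-m - (l.length : ℝ) * δ₀) = s i ^ l.length * (i : ℝ) ^ (-m) := by
      simp only [s]
      rw [← Real.rpow_natCast, ← Real.rpow_mul (hpos i).le, ← Real.rpow_add (hpos i)]
      congr 1; ring
    rw [h2]
  let A : ℕ → Set.Ioc (0:ℝ) h₀ → E2 d → ℂ := fun k i => (ampStep (X i))^[k] (b i)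
  have hA1 : ∀ k i, A (k+1) i = ampStep (X i) (A k i) := fun k i =>
    Function.iterate_succ_apply' _ _ _
  have hA : ∀ k, (∀ i, ContDiff ℝ (⊤ : ℕ∞) (A k i)) ∧
      (∀ i : Set.Ioc (0:ℝ) h₀, tsupport (A k i) ⊆ tsupport (b i)) ∧
      ∀ n, SymB U s n (fun i _ => s i ^ (2 * k) * (i : ℝ) ^ (-m)) (A k) := by
    intro k
    induction k with
    | zero =>
      refine ⟨hbm, fun i => le_rfl, fun n => ?_⟩
      have e0 : A 0 = fun i : Set.Ioc (0:ℝ) h₀ => b i := rfl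
      rw [e0]
      simpa using hbs n
    | succ k ih =>
      obtain ⟨ih1, ih2, ih3⟩ := ih
      have e : A (k+1) = fun i => ampStep (X i) (A k i) := funext fun i => hA1 k i
      rw [e]
      refine ⟨fun i => ampStep_smooth (hU i) (hXm i) (ih1 i) ((ih2 i).trans (hbU i)),
        fun i => (ampStep_tsupport _ _).trans (ih2 i), fun n => ?_⟩
      refine SymB.mono hs zero_le_one (fun i v hv => le_of_eq ?_)
        (ampStep_sym hU hXm ih1 hXc ih3 n)
      ring
  have hint : ∀ (lam : ℝ) (i : Set.Ioc (0:ℝ) h₀) (k : ℕ),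
      |lam| ^ k * ‖∫ v, Complex.exp (Complex.I * lam * p i v) * b i v‖ =
        ‖∫ v, Complex.exp (Complex.I * lam * p i v) * A k i v‖ := by
    intro lam i k
    induction k with
    | zero => simp [A]
    | succ k ih =>
      obtain ⟨h1, h2, h3⟩ := hA k
      have hc : HasCompactSupport (A k i) :=
        hΓ.of_isClosed_subset isClosed_closure ((h2 i).trans (hbsupp i i.2))
      have h4 := ibp (hU i) (hsm i) lam (hXm i) (h1 i) ((h2 i).trans (hbU i)) hc (hX1 i)
      rw [hA1, ← norm_neg (∫ v, Complex.exp (Complex.I * lam * p i v) * ampStep (X i) (A k i) v),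
        ← h4, norm_mul, ← ih]
      simp only [norm_mul, Complex.norm_I, Complex.norm_real, Real.norm_eq_abs, one_mul]
      ring
  have hbound : ∀ k, ∃ C : ℝ, 0 ≤ C ∧ ∀ (lam : ℝ) (i : Set.Ioc (0:ℝ) h₀),
      ‖∫ v, Complex.exp (Complex.I * lam * p i v) * A k i v‖ ≤
        C * (s i ^ (2 * k) * (i : ℝ) ^ (-m)) := by
    intro k
    obtain ⟨h1, h2, h3⟩ := hA k
    obtain ⟨C, hC0, hC⟩ := h3 0
    refine ⟨C * volume.real Γ₀, by positivity, fun lam i => ?_⟩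
    have hw : 0 ≤ s i ^ (2 * k) * (i : ℝ) ^ (-m) :=
      mul_nonneg (pow_nonneg (hs i) _) (Real.rpow_pos_of_pos (hpos i) _).le
    have hout : ∀ v, v ∉ tsupport (b i) → A k i v = 0 := by
      intro v hv
      by_contra h
      exact hv (h2 i (subset_closure h))
    rw [← setIntegral_eq_integral_of_forall_compl_eq_zero (s := Γ₀) (fun v hv => by
      rw [hout v (fun h => hv (hbsupp i i.2 h)), mul_zero])]
    have := norm_setIntegral_le_of_norm_le_const (μ := volume) (s := Γ₀)
      (f := fun v => Complex.exp (Complex.I * lam * p i v) * A k i v)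
      (C := C * (s i ^ (2 * k) * (i : ℝ) ^ (-m))) hΓ.measure_lt_top (fun v _ => by
        have he : ‖Complex.exp (Complex.I * lam * p i v)‖ = 1 := by
          have : Complex.I * lam * p i v = ((lam * p i v : ℝ) : ℂ) * Complex.I := by
            push_cast; ring
          rw [this, Complex.norm_exp_ofReal_mul_I]
        rw [norm_mul, he, one_mul]
        by_cases hv : v ∈ tsupport (b i)
        · exact hC i v (hbU i hv)
        · rw [hout v hv, norm_zero]; exact mul_nonneg hC0 hw)
    refine this.trans (le_of_eq ?_)
    ring
  intro N
  obtain ⟨k, hk⟩ := exists_nat_ge ((N + m) / (μ - 2 * δ₀))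
  have hk' : (N : ℝ) ≤ k * (μ - 2 * δ₀) - m := by
    rw [div_le_iff₀ (by linarith)] at hk
    linarith
  obtain ⟨C, hC0, hC⟩ := hbound k
  refine ⟨C, fun h hh t ht1 ht2 => ?_⟩
  have hh0 : 0 < h := hh.1
  have e1 : ∀ v, Complex.exp (Complex.I * t * p h v / h) * b h v =
      Complex.exp (Complex.I * ((t / h : ℝ) : ℂ) * p h v) * b h v := by
    intro v
    congr 2
    push_cast
    ring
  simp only [e1]
  have h1 := hint (t / h) ⟨h, hh⟩ k
  have h2 := hC (t / h) ⟨h, hh⟩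
  rw [← h1] at h2
  simp only at h2
  set J := ‖∫ v, Complex.exp (Complex.I * ((t / h : ℝ) : ℂ) * p h v) * b h v‖ with hJ
  have hJ0 : 0 ≤ J := norm_nonneg _
  have hl : h ^ (-μ) ≤ |t / h| := by
    rw [abs_div, abs_of_pos hh0, le_div_iff₀ hh0]
    refine le_trans (le_of_eq ?_) ht1
    nth_rewrite 2 [← Real.rpow_one h]
    rw [← Real.rpow_add hh0]
    congr 1; ring
  have hl' : (h ^ (-μ)) ^ k ≤ |t / h| ^ k :=
    pow_le_pow_left₀ (Real.rpow_pos_of_pos hh0 _).le hl k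
  have h3 : (h ^ (-μ)) ^ k * J ≤ C * ((h ^ (-δ₀)) ^ (2 * k) * h ^ (-m)) :=
    (mul_le_mul_of_nonneg_right hl' hJ0).trans h2
  have h4 : h ^ (μ * k) * (h ^ (-μ)) ^ k = 1 := by
    rw [← Real.rpow_natCast, ← Real.rpow_mul hh0.le, ← Real.rpow_add hh0]
    simp
  have h5 : h ^ (μ * k) * ((h ^ (-δ₀)) ^ (2 * k) * h ^ (-m)) = h ^ (k * (μ - 2 * δ₀) - m) := by
    rw [← Real.rpow_natCast, ← Real.rpow_mul hh0.le, ← Real.rpow_add hh0, ← Real.rpow_add hh0]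
    congr 1
    push_cast
    ring
  have h6 : h ^ (k * (μ - 2 * δ₀) - m) ≤ h ^ N := by
    rw [← Real.rpow_natCast]
    exact Real.rpow_le_rpow_of_exponent_ge hh0 (hh.2.trans hh₀1) hk'
  have h7 := mul_le_mul_of_nonneg_left h3 (Real.rpow_pos_of_pos hh0 (μ * k)).le
  calc J = h ^ (μ * k) * ((h ^ (-μ)) ^ k * J) := by rw [← mul_assoc, h4, one_mul]
    _ ≤ h ^ (μ * k) * (C * ((h ^ (-δ₀)) ^ (2 * k) * h ^ (-m))) := h7
    _ = C * h ^ (k * (μ - 2 * δ₀) - m) := by rw [← h5]; ring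
    _ ≤ C * h ^ N := mul_le_mul_of_nonneg_left h6 hC0


end
end

section
/- Let d ≥ 1, let J : ℝ^{2d} → ℝ^{2d} be the standard symplectic matrix, J(x,ξ) = (ξ, −x), and let M > 0. Then there exists t₀ ∈ (0,1] depending only on M and d such that: for every twice continuously differentiable p : ℝ^{2d} → ℝ whose Hessian satisfies ‖d²p(w)‖ ≤ M for all w ∈ ℝ^{2d}, every v ∈ ℝ^{2d}, and every differentiable curve θ : [−1,1] → ℝ^{2d} with θ(0) = v and θ′(t) = J∇p(θ(t)) for all t, one has |θ(t) − v| ≥ |t| |∇p(v)| / 2 for all t ∈ [−t₀, t₀]. -/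
open MeasureTheory

noncomputable section

/-- The standard symplectic matrix `J(x,ξ) = (ξ,−x)` on `ℝ^{2d}`. -/
noncomputable def Jmap (d : ℕ) : E2 d → E2 d :=
  fun v => (EuclideanSpace.equiv (Fin d ⊕ Fin d) ℝ).symm
    (Sum.elim (fun j => v (Sum.inr j)) (fun j => - v (Sum.inl j)))

theorem Jmap_norm_sub_aux (d : ℕ) (a b : E2 d) : ‖Jmap d a - Jmap d b‖ = ‖a - b‖ := by
  rw [EuclideanSpace.norm_eq, EuclideanSpace.norm_eq]
  congr 1
  simp only [Fintype.sum_sum_type, Jmap]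
  rw [add_comm]
  congr 1
  · refine Finset.sum_congr rfl fun i _ => ?_
    simp
    ring

theorem Jmap_norm_aux (d : ℕ) (a : E2 d) : ‖Jmap d a‖ = ‖a‖ := by
  have h0 : Jmap d 0 = 0 := by
    ext i
    rcases i with i | i <;> simp [Jmap]
  have h := Jmap_norm_sub_aux d a 0
  rwa [h0, sub_zero, sub_zero] at h

theorem gradient_lip_aux {d : ℕ} {M : ℝ} {p : E2 d → ℝ} (hp : ContDiff ℝ 2 p)
    (hb : ∀ w : E2 d, ‖iteratedFDeriv ℝ 2 p w‖ ≤ M) (a b : E2 d) :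
    ‖gradient p a - gradient p b‖ ≤ M * ‖a - b‖ := by
  have h1 : ‖gradient p a - gradient p b‖ = ‖fderiv ℝ p a - fderiv ℝ p b‖ := by
    unfold gradient
    rw [← map_sub, LinearIsometryEquiv.norm_map]
  rw [h1]
  have hd : Differentiable ℝ (fderiv ℝ p) :=
    (hp.fderiv_right (m := 1) (by norm_num)).differentiable (by norm_num)
  refine Convex.norm_image_sub_le_of_norm_fderiv_le (𝕜 := ℝ) (s := Set.univ)
    (fun x _ => hd x) (fun x _ => ?_) convex_univ (Set.mem_univ b) (Set.mem_univ a)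
  have h2 : ‖fderiv ℝ (fderiv ℝ p) x‖ = ‖iteratedFDeriv ℝ 2 p x‖ := by
    rw [← norm_iteratedFDeriv_fderiv (n := 1), ← norm_fderiv_iteratedFDeriv (n := 0) (f := fderiv ℝ p)] 
    rw [iteratedFDeriv_zero_eq_comp]
    rw [LinearIsometryEquiv.comp_fderiv]
    exact (LinearIsometry.norm_toContinuousLinearMap_comp _).symm
  rw [h2]
  exact hb x

/-- Lemma 5.1: for `t₀` small enough (depending only on the Hessian bound `M` and `d`),
a Hamiltonian trajectory satisfies `|θ(t) − v| ≥ |t||∇p(v)|/2` for `|t| ≤ t₀`. -/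
theorem flow_displacement_lower_bound {d : ℕ} (hd : 1 ≤ d) (M : ℝ) (hM : 0 < M) :
    ∃ t₀ : ℝ, 0 < t₀ ∧ t₀ ≤ 1 ∧
      ∀ p : E2 d → ℝ, ContDiff ℝ 2 p →
        (∀ w : E2 d, ‖iteratedFDeriv ℝ 2 p w‖ ≤ M) →
        ∀ v : E2 d, ∀ θ : ℝ → E2 d, θ 0 = v →
          (∀ t ∈ Set.Icc (-1:ℝ) 1, HasDerivAt θ (Jmap d (gradient p (θ t))) t) →
          ∀ t ∈ Set.Icc (-t₀) t₀, |t| * ‖gradient p v‖ / 2 ≤ ‖θ t - v‖ := by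
  refine ⟨min 1 (1 / (4 * M)), by positivity, min_le_left _ _, ?_⟩
  set t₀ := min 1 (1 / (4 * M)) with ht₀
  have ht0 : 0 < t₀ := by positivity
  have ht1 : t₀ ≤ 1 := min_le_left _ _
  have htM : t₀ * M ≤ 1 / 4 := by
    have h : t₀ ≤ 1 / (4 * M) := min_le_right _ _
    rw [le_div_iff₀ (by positivity)] at h
    linarith
  intro p hp hb v θ hv hθ t ht
  have hsub : ∀ s ∈ Set.Icc (-t₀) t₀, s ∈ Set.Icc (-1:ℝ) 1 := fun s hs =>
    ⟨by linarith [hs.1], by linarith [hs.2]⟩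
  have hcont : ContinuousOn (fun s => ‖θ s - v‖) (Set.Icc (-t₀) t₀) := fun s hs =>
    (((hθ s (hsub s hs)).continuousAt.sub continuousAt_const).norm).continuousWithinAt
  obtain ⟨m, hm, hmax⟩ := isCompact_Icc.exists_isMaxOn ⟨t, ht⟩ hcont
  set R := ‖θ m - v‖ with hR
  set g := Jmap d (gradient p v) with hg
  have hgn : ‖g‖ = ‖gradient p v‖ := Jmap_norm_aux d _
  have h0 : (0:ℝ) ∈ Set.Icc (-t₀) t₀ := ⟨by linarith, by linarith⟩
  have key : ∀ s ∈ Set.Icc (-t₀) t₀, ‖(θ s - v) - s • g‖ ≤ M * R * |s| := by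
    intro s hs
    have hder : ∀ x ∈ Set.Icc (-t₀) t₀, HasDerivWithinAt (fun x => θ x - x • g)
        (Jmap d (gradient p (θ x)) - g) (Set.Icc (-t₀) t₀) x := by
      intro x hx
      have h := (hθ x (hsub x hx)).sub ((hasDerivAt_id x).smul_const g)
      rw [one_smul] at h
      exact h.hasDerivWithinAt
    have h := (convex_Icc (-t₀) t₀).norm_image_sub_le_of_norm_hasDerivWithin_le
      (C := M * R) hder (fun x hx => by
        rw [hg, Jmap_norm_sub_aux]
        refine (gradient_lip_aux hp hb _ _).trans ?_
        exact mul_le_mul_of_nonneg_left (hmax hx) hM.le) h0 hs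
    simp only [hv, zero_smul, sub_zero, Real.norm_eq_abs] at h
    rwa [sub_right_comm]
  have hG := norm_nonneg (gradient p v)
  have hR0 : 0 ≤ R := norm_nonneg _
  have hMR : M * R ≤ ‖gradient p v‖ / 3 := by
    have h1 := key m hm
    have h2 : R ≤ ‖(θ m - v) - m • g‖ + ‖m • g‖ := by
      have := norm_add_le ((θ m - v) - m • g) (m • g)
      rwa [sub_add_cancel] at this
    rw [norm_smul, hgn, Real.norm_eq_abs] at h2
    have hmt : |m| ≤ t₀ := abs_le.2 hm
    have h3 : R ≤ t₀ * (M * R + ‖gradient p v‖) := by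
      have : |m| * (M * R + ‖gradient p v‖) ≤ t₀ * (M * R + ‖gradient p v‖) :=
        mul_le_mul_of_nonneg_right hmt (by positivity)
      linarith
    have h4 : M * R ≤ (t₀ * M) * (M * R + ‖gradient p v‖) := by
      have := mul_le_mul_of_nonneg_left h3 hM.le
      linarith
    have h5 : (t₀ * M) * (M * R + ‖gradient p v‖) ≤ 1 / 4 * (M * R + ‖gradient p v‖) :=
      mul_le_mul_of_nonneg_right htM (by positivity)
    linarith
  have h1 := key t ht
  have h2 : ‖t • g‖ ≤ ‖θ t - v‖ + ‖(θ t - v) - t • g‖ := by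
    have := norm_sub_le (θ t - v) ((θ t - v) - t • g)
    rwa [sub_sub_cancel] at this
  rw [norm_smul, hgn, Real.norm_eq_abs] at h2
  have h3 := mul_le_mul_of_nonneg_right hMR (abs_nonneg t)
  have h4 : 0 ≤ |t| * ‖gradient p v‖ := by positivity
  linarith

end
end

section
/- Let d ≥ 2, m₀ ≥ 1, 0<r₀<1, and let a₀ be the elliptic symbol defined in the context. Fix δ₀ > 0, C̄ > 0, h₀ ∈ (0,1], and let v̄ ∈ ℝ^{2d} be such that the Hessian matrix d²a₀(v̄) has rank ≥ 2. Then there exist ε > 0, C > 0 and linearly independent vectors e₁, e₂, e₃ ∈ ℝ^{2d} with e₃ ∈ {0}×ℝ^d such that for every k ∈ {1,2,3}, every v ∈ ℝ^{2d} and every h ∈ (0,h₀], the Lebesgue measure of the set {s ∈ ℝ : |s·e_k + v − v̄| < ε and |∇a₀(s·e_k + v)| ≤ C̄ h^{δ₀}} is at most C h^{ρ_k}, where ρ₁ = ρ₂ = δ₀ and ρ₃ = δ₀/(2m₀−1). The constant C is independent of h and v. -/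
open MeasureTheory

noncomputable section

/-- `a ∈ C_b^{2+r₀}(ℝ^d)` : `a` is twice continuously differentiable, its derivatives of
order `≤ 2` are bounded, and the second order derivatives are uniformly `r₀`-Hölder. -/
def CbHolder {d : ℕ} (r₀ : ℝ) (a : EuclideanSpace ℝ (Fin d) → ℝ) : Prop :=
  ContDiff ℝ 2 a ∧
  (∀ k : ℕ, k ≤ 2 → ∃ C : ℝ, ∀ x, ‖iteratedFDeriv ℝ k a x‖ ≤ C) ∧
  ∃ C : ℝ, ∀ x y, ‖iteratedFDeriv ℝ 2 a x - iteratedFDeriv ℝ 2 a y‖ ≤ C * ‖x - y‖ ^ r₀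

/-- The Finset of multi-indices `ν ∈ ℕ^d` with `|ν| ≤ m₀` (encoded with components `≤ m₀`). -/
def MIdx (d m₀ : ℕ) : Finset (Fin d → Fin (m₀+1)) :=
  Finset.univ.filter fun ν => (∑ j, (ν j : ℕ)) ≤ m₀

/-- The `x`-component of a phase space point. -/
noncomputable def xpart {d : ℕ} (v : E2 d) : EuclideanSpace ℝ (Fin d) :=
  (EuclideanSpace.equiv (Fin d) ℝ).symm fun j => v (Sum.inl j)

/-- The principal symbol `a₀(x,ξ) = Σ_{|ν|,|ν̄|≤m₀} a_{ν,ν̄}(x) ξ^{ν+ν̄}`. -/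
noncomputable def symb {d m₀ : ℕ}
    (a : (Fin d → Fin (m₀+1)) → (Fin d → Fin (m₀+1)) → EuclideanSpace ℝ (Fin d) → ℝ) :
    E2 d → ℝ :=
  fun v => ∑ ν ∈ MIdx d m₀, ∑ ν' ∈ MIdx d m₀,
    a ν ν' (xpart v) * ∏ j, v (Sum.inr j) ^ ((ν j : ℕ) + (ν' j : ℕ))

/-- The ellipticity condition `Σ_{|ν|=|ν̄|=m₀} a_{ν,ν̄}(x) ξ^{ν+ν̄} ≥ c₀|ξ|^{2m₀}`. -/
def Elliptic {d m₀ : ℕ}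
    (a : (Fin d → Fin (m₀+1)) → (Fin d → Fin (m₀+1)) → EuclideanSpace ℝ (Fin d) → ℝ) : Prop :=
  ∃ c₀ : ℝ, 0 < c₀ ∧ ∀ x ξ : EuclideanSpace ℝ (Fin d),
    c₀ * ‖ξ‖ ^ (2 * m₀) ≤
      ∑ ν ∈ (Finset.univ.filter fun ν : Fin d → Fin (m₀+1) => (∑ j, (ν j : ℕ)) = m₀),
        ∑ ν' ∈ (Finset.univ.filter fun ν' : Fin d → Fin (m₀+1) => (∑ j, (ν' j : ℕ)) = m₀),
          a ν ν' x * ∏ j, ξ j ^ ((ν j : ℕ) + (ν' j : ℕ))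

/-- The Hessian matrix `d²f(v)` of a function on phase space. -/
noncomputable def hess {d : ℕ} (f : E2 d → ℝ) (v : E2 d) :
    Matrix (Fin d ⊕ Fin d) (Fin d ⊕ Fin d) ℝ :=
  Matrix.of fun i j => pd i (pd j f) v

/-- Sublevel sets of a real polynomial with a lower bound on the leading coefficient. -/
lemma poly_sublevel (p : Polynomial ℝ) (n : ℕ) (hn : 1 ≤ n) (hdeg : p.natDegree ≤ n) (c δ : ℝ)
    (hc : 0 < c) (hδ : 0 ≤ δ) (hcoef : c ≤ p.coeff n) :
    volume {s : ℝ | |p.eval s| ≤ δ} ≤ ENNReal.ofReal (2 * n * (δ / c) ^ ((1:ℝ) / n)) := by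
  have hpn : p.natDegree = n :=
    le_antisymm hdeg (Polynomial.le_natDegree_of_ne_zero (by linarith))
  have hlead : p.leadingCoeff = p.coeff n := by rw [Polynomial.leadingCoeff, hpn]
  set q : Polynomial ℂ := p.map (algebraMap ℝ ℂ) with hq
  have hsplit : q.Splits := IsAlgClosed.splits q
  have hcard : q.roots.card = n := by
    rw [← hsplit.natDegree_eq_card_roots, hq, Polynomial.natDegree_map, hpn]
  have hqlead : q.leadingCoeff = ((p.coeff n : ℝ) : ℂ) := by
    rw [hq, Polynomial.leadingCoeff_map, hlead]; rfl
  set r : ℝ := (δ / c) ^ ((1:ℝ) / n) with hr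
  have hr0 : 0 ≤ r := by positivity
  have hrn : r ^ n = δ / c := by
    rw [hr, one_div, Real.rpow_inv_natCast_pow (by positivity) (by omega)]
  have hsub : {s : ℝ | |p.eval s| ≤ δ} ⊆
      ⋃ z ∈ q.roots.toFinset, Set.Icc (z.re - r) (z.re + r) := by
    intro s hs
    simp only [Set.mem_ofPred_eq] at hs
    by_contra hcon
    simp only [Set.mem_iUnion, not_exists, Multiset.mem_toFinset] at hcon
    have hfar : ∀ z ∈ q.roots, r < ‖(s:ℂ) - z‖ := by
      intro z hz
      have h1 := hcon z hz
      by_contra h2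
      push Not at h2
      apply h1
      have h3 : |s - z.re| ≤ r := by
        have := Complex.abs_re_le_norm ((s:ℂ) - z)
        simp only [Complex.sub_re, Complex.ofReal_re] at this
        linarith
      rw [abs_le] at h3
      constructor <;> linarith
    have heval : ‖q.eval (s:ℂ)‖ = |p.eval s| := by
      have : q.eval (s:ℂ) = ((p.eval s : ℝ) : ℂ) := by
        rw [hq]
        exact Polynomial.eval_map_algebraMap p (s:ℂ) |>.trans (Polynomial.aeval_algebraMap_apply ℂ s p)
      rw [this, Complex.norm_real, Real.norm_eq_abs]
    have hprod : ‖q.eval (s:ℂ)‖ = p.coeff n * (q.roots.map fun z => ‖(s:ℂ) - z‖).prod := by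
      conv_lhs => rw [hsplit.eq_prod_roots]
      rw [Polynomial.eval_mul, Polynomial.eval_C, norm_mul, hqlead, Complex.norm_real,
        Real.norm_eq_abs, abs_of_pos (by linarith), Polynomial.eval_multiset_prod, Multiset.map_map]
      congr 1
      have := map_multiset_prod (normHom : ℂ →*₀ ℝ) (Multiset.map (fun z => (s:ℂ) - z) q.roots)
      rw [Multiset.map_map] at this
      simpa [Function.comp_def] using this
    have hlt : r ^ n < (q.roots.map fun z => ‖(s:ℂ) - z‖).prod := by
      have gen : ∀ m : Multiset ℂ, 1 ≤ m.card → (∀ z ∈ m, r < ‖(s:ℂ) - z‖) →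
          r ^ m.card < (m.map fun z => ‖(s:ℂ) - z‖).prod := by
        intro m
        induction m using Multiset.induction with
        | empty => simp
        | cons z m ih =>
          intro _ hm
          simp only [Multiset.card_cons, Multiset.map_cons, Multiset.prod_cons]
          have hz := hm z (by simp)
          rcases Nat.eq_zero_or_pos m.card with h0 | h0
          · rw [Multiset.card_eq_zero] at h0
            subst h0; simpa using hz
          · have := ih h0 (fun w hw => hm w (by simp [hw]))
            rw [pow_succ']
            exact mul_lt_mul'' hz this hr0 (by positivity)
      have := gen q.roots (by omega) hfar
      rwa [hcard] at this
    rw [hrn] at hlt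
    have h5 : δ < c * (q.roots.map fun z => ‖(s:ℂ) - z‖).prod := by
      rw [div_lt_iff₀ hc] at hlt; linarith
    have h6 : 0 < (q.roots.map fun z => ‖(s:ℂ) - z‖).prod :=
      lt_of_le_of_lt (by positivity) hlt
    have : δ < |p.eval s| := by
      rw [← heval, hprod]
      nlinarith
    linarith
  calc volume {s : ℝ | |p.eval s| ≤ δ}
      ≤ volume (⋃ z ∈ q.roots.toFinset, Set.Icc (z.re - r) (z.re + r)) := measure_mono hsub
    _ ≤ ∑ z ∈ q.roots.toFinset, volume (Set.Icc (z.re - r) (z.re + r)) :=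
        measure_biUnion_finset_le _ _
    _ = ∑ z ∈ q.roots.toFinset, ENNReal.ofReal (2 * r) := by
        refine Finset.sum_congr rfl fun z _ => ?_
        rw [Real.volume_Icc]; congr 1; ring
    _ = (q.roots.toFinset.card : ENNReal) * ENNReal.ofReal (2 * r) := by simp
    _ ≤ (n : ENNReal) * ENNReal.ofReal (2 * r) := by
        gcongr
        rw [← hcard]; exact Multiset.toFinset_card_le _
    _ = ENNReal.ofReal (2 * n * r) := by
        rw [← ENNReal.ofReal_natCast, ← ENNReal.ofReal_mul (by positivity)]
        congr 1; ring

/-- Sublevel sets of a function with derivative bounded below on a convex set. -/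
lemma mono_sublevel (g g' : ℝ → ℝ) (hg : ∀ s, HasDerivAt g (g' s) s) (S : Set ℝ)
    (hS : Convex ℝ S) (κ M : ℝ) (hκ : 0 < κ) (hg' : ∀ s ∈ S, κ ≤ g' s) :
    volume {s : ℝ | s ∈ S ∧ |g s| ≤ M} ≤ ENNReal.ofReal (2 * M / κ) := by
  refine (Real.volume_le_diam _).trans ?_
  refine Metric.ediam_le fun s hs t ht => ?_
  have key : ∀ s t, s ≤ t → (s ∈ S ∧ |g s| ≤ M) → (t ∈ S ∧ |g t| ≤ M) → t - s ≤ 2 * M / κ := by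
    intro s t hst hs ht
    have h := hS.mul_sub_le_image_sub_of_le_deriv (f := g) (C := κ)
      (fun s _ => (hg s).continuousAt.continuousWithinAt)
      (fun s _ => (hg s).differentiableAt.differentiableWithinAt)
      (fun s h => by rw [(hg s).deriv]; exact hg' s (interior_subset h)) s hs.1 t ht.1 hst
    have h1 := abs_le.1 hs.2
    have h2 := abs_le.1 ht.2
    rw [le_div_iff₀ hκ]
    linarith
  rw [edist_dist, Real.dist_eq]
  apply ENNReal.ofReal_le_ofReal
  rcases le_total s t with h | h
  · rw [abs_sub_comm, abs_of_nonneg (by linarith)]; exact key s t h hs ht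
  · rw [abs_of_nonneg (by linarith)]; exact key t s h ht hs

lemma contDiff_symb {d m₀ : ℕ} {r₀ : ℝ}
    (a : (Fin d → Fin (m₀+1)) → (Fin d → Fin (m₀+1)) → EuclideanSpace ℝ (Fin d) → ℝ)
    (hreg : ∀ ν ν', CbHolder r₀ (a ν ν')) : ContDiff ℝ 2 (symb a) := by
  unfold symb
  have hx : ContDiff ℝ 2 (xpart : E2 d → EuclideanSpace ℝ (Fin d)) := by
    unfold xpart
    refine (EuclideanSpace.equiv (Fin d) ℝ).symm.contDiff.comp ?_
    fun_prop
  refine ContDiff.sum fun ν _ => ContDiff.sum fun ν' _ => ?_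
  refine ContDiff.mul ((hreg ν ν').1.comp hx) ?_
  refine contDiff_prod fun j _ => ContDiff.pow ?_ _
  fun_prop

/-- The polynomial `s ↦ a₀(x, ξ + s η)`. -/
def linePoly {d m₀ : ℕ}
    (a : (Fin d → Fin (m₀+1)) → (Fin d → Fin (m₀+1)) → EuclideanSpace ℝ (Fin d) → ℝ)
    (x : EuclideanSpace ℝ (Fin d)) (ξ η : Fin d → ℝ) : Polynomial ℝ :=
  ∑ ν ∈ MIdx d m₀, ∑ ν' ∈ MIdx d m₀, Polynomial.C (a ν ν' x) *
    ∏ j, (Polynomial.C (η j) * Polynomial.X + Polynomial.C (ξ j)) ^ ((ν j : ℕ) + (ν' j : ℕ))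

lemma natDegree_mono {d : ℕ} (ξ η : Fin d → ℝ) (n : Fin d → ℕ) :
    (∏ j, (Polynomial.C (η j) * Polynomial.X + Polynomial.C (ξ j)) ^ (n j)).natDegree
      ≤ ∑ j, n j := by
  refine (Polynomial.natDegree_prod_le _ _).trans (Finset.sum_le_sum fun j _ => ?_)
  refine Polynomial.natDegree_pow_le.trans ?_
  have : (Polynomial.C (η j) * Polynomial.X + Polynomial.C (ξ j)).natDegree ≤ 1 :=
    Polynomial.natDegree_linear_le
  nlinarith

lemma coeff_mono {d : ℕ} (ξ η : Fin d → ℝ) (n : Fin d → ℕ) :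
    (∏ j, (Polynomial.C (η j) * Polynomial.X + Polynomial.C (ξ j)) ^ (n j)).coeff (∑ j, n j)
      = ∏ j, η j ^ n j := by
  have gen : ∀ s : Finset (Fin d), (∏ j ∈ s, (Polynomial.C (η j) * Polynomial.X +
        Polynomial.C (ξ j)) ^ (n j)).natDegree ≤ ∑ j ∈ s, n j ∧ 
      (∏ j ∈ s, (Polynomial.C (η j) * Polynomial.X +
        Polynomial.C (ξ j)) ^ (n j)).coeff (∑ j ∈ s, n j) = ∏ j ∈ s, η j ^ n j := by
    intro s
    induction s using Finset.induction with
    | empty => simp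
    | insert j s hj ih =>
      rw [Finset.prod_insert hj, Finset.sum_insert hj, Finset.prod_insert hj]
      have h1 : (Polynomial.C (η j) * Polynomial.X + Polynomial.C (ξ j)).natDegree ≤ 1 :=
        Polynomial.natDegree_linear_le
      have h2 : ((Polynomial.C (η j) * Polynomial.X + Polynomial.C (ξ j)) ^ n j).natDegree
          ≤ n j := by
        refine Polynomial.natDegree_pow_le.trans ?_
        nlinarith
      refine ⟨Polynomial.natDegree_mul_le_of_le h2 ih.1, ?_⟩
      rw [Polynomial.coeff_mul_add_eq_of_natDegree_le h2 ih.1, ih.2]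
      congr 1
      have := Polynomial.coeff_pow_of_natDegree_le (m := n j) h1
      rw [mul_one] at this
      rw [this]; simp
  exact (gen Finset.univ).2

lemma linePoly_natDegree {d m₀ : ℕ}
    (a : (Fin d → Fin (m₀+1)) → (Fin d → Fin (m₀+1)) → EuclideanSpace ℝ (Fin d) → ℝ)
    (x : EuclideanSpace ℝ (Fin d)) (ξ η : Fin d → ℝ) :
    (linePoly a x ξ η).natDegree ≤ 2 * m₀ := by
  unfold linePoly
  refine Polynomial.natDegree_sum_le_of_forall_le _ _ fun ν hν =>
    Polynomial.natDegree_sum_le_of_forall_le _ _ fun ν' hν' => ?_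
  refine (Polynomial.natDegree_C_mul_le _ _).trans ?_
  refine (natDegree_mono ξ η _).trans ?_
  simp only [MIdx, Finset.mem_filter, Finset.mem_univ, true_and] at hν hν'
  rw [Finset.sum_add_distrib]; omega

lemma linePoly_coeff {d m₀ : ℕ}
    (a : (Fin d → Fin (m₀+1)) → (Fin d → Fin (m₀+1)) → EuclideanSpace ℝ (Fin d) → ℝ)
    (x : EuclideanSpace ℝ (Fin d)) (ξ η : Fin d → ℝ) :
    (linePoly a x ξ η).coeff (2 * m₀) =
      ∑ ν ∈ (Finset.univ.filter fun ν : Fin d → Fin (m₀+1) => (∑ j, (ν j : ℕ)) = m₀),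
        ∑ ν' ∈ (Finset.univ.filter fun ν' : Fin d → Fin (m₀+1) => (∑ j, (ν' j : ℕ)) = m₀),
          a ν ν' x * ∏ j, η j ^ ((ν j : ℕ) + (ν' j : ℕ)) := by
  unfold linePoly
  simp only [Polynomial.finsetSum_coeff, Polynomial.coeff_C_mul]
  have hsub : (Finset.univ.filter fun ν : Fin d → Fin (m₀+1) => (∑ j, (ν j : ℕ)) = m₀)
      ⊆ MIdx d m₀ := by
    intro ν hν
    simp only [MIdx, Finset.mem_filter, Finset.mem_univ, true_and] at hν ⊢
    omega
  have hzero : ∀ ν ∈ MIdx d m₀, ∀ ν' ∈ MIdx d m₀,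
      (∑ j, (ν j : ℕ)) ≠ m₀ ∨ (∑ j, (ν' j : ℕ)) ≠ m₀ →
      a ν ν' x * (∏ j, (Polynomial.C (η j) * Polynomial.X + Polynomial.C (ξ j)) ^
        ((ν j : ℕ) + (ν' j : ℕ))).coeff (2 * m₀) = 0 := by
    intro ν hν ν' hν' h
    rw [Polynomial.coeff_eq_zero_of_natDegree_lt, mul_zero]
    refine (natDegree_mono ξ η _).trans_lt ?_
    simp only [MIdx, Finset.mem_filter, Finset.mem_univ, true_and] at hν hν'
    rw [Finset.sum_add_distrib]; omega
  symm
  refine (Finset.sum_congr rfl fun ν hν => ?_).trans (Finset.sum_subset hsub fun ν hν hν2 => ?_)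
  · refine (Finset.sum_congr rfl fun ν' hν' => ?_).trans
      (Finset.sum_subset hsub fun ν' hν' hν2 => ?_)
    · simp only [Finset.mem_filter, Finset.mem_univ, true_and] at hν hν'
      have h : 2 * m₀ = ∑ j, ((ν j : ℕ) + (ν' j : ℕ)) := by
        rw [Finset.sum_add_distrib]; omega
      rw [h, coeff_mono]
    · exact hzero ν (hsub hν) ν' hν' (Or.inr (by simpa using hν2))
  · exact Finset.sum_eq_zero fun ν' hν' => hzero ν hν ν' hν' (Or.inl (by simpa using hν2))

lemma exists_notMem_two {E : Type*} [AddCommGroup E] [Module ℝ E] (p q : Submodule ℝ E)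
    (hp : p ≠ ⊤) (hq : q ≠ ⊤) : ∃ x, x ∉ p ∧ x ∉ q := by
  obtain ⟨x, hx⟩ : ∃ x, x ∉ p := by
    by_contra h; push Not at h; exact hp (eq_top_iff.2 fun x _ => h x)
  obtain ⟨y, hy⟩ : ∃ x, x ∉ q := by
    by_contra h; push Not at h; exact hq (eq_top_iff.2 fun x _ => h x)
  by_cases hxq : x ∈ q
  · by_cases hyp : y ∈ p
    · exact ⟨x + y, fun h => hx ((p.add_mem_iff_left hyp).1 h),
        fun h => hy ((q.add_mem_iff_right hxq).1 h)⟩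
    · exact ⟨y, hyp, hy⟩
  · exact ⟨x, hx, hxq⟩

lemma norm_gradient_eq {E : Type*} [NormedAddCommGroup E] [InnerProductSpace ℝ E] [CompleteSpace E]
    (f : E → ℝ) (x : E) : ‖gradient f x‖ = ‖fderiv ℝ f x‖ := by
  simp [gradient]

/-- Lemma 6.4: near a point `v̄` where the Hessian of `a₀` has rank `≥ 2`, there are
linearly independent directions `e₁, e₂, e₃` (with `e₃ ∈ {0}×ℝ^d`) along which the set
`{|∇a₀| ≤ C̄h^{δ₀}}` has one-dimensional measure `O(h^{ρ_k})`, where `ρ₁ = ρ₂ = δ₀` and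
`ρ₃ = δ₀/(2m₀−1)`, uniformly in `v`. -/
theorem critical_set_line_measure {d m₀ : ℕ} (hd : 2 ≤ d) (hm : 1 ≤ m₀)
    {r₀ δ₀ Cb h₀ : ℝ} (hr₀ : 0 < r₀) (hr₁ : r₀ < 1) (hδ₀ : 0 < δ₀) (hCb : 0 < Cb)
    (hh₀ : 0 < h₀) (hh₀1 : h₀ ≤ 1)
    (a : (Fin d → Fin (m₀+1)) → (Fin d → Fin (m₀+1)) → EuclideanSpace ℝ (Fin d) → ℝ)
    (hsym : ∀ ν ν', a ν ν' = a ν' ν)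
    (hreg : ∀ ν ν', CbHolder r₀ (a ν ν'))
    (hell : Elliptic a)
    (vbar : E2 d) (hrank : 2 ≤ (hess (symb a) vbar).rank) :
    ∃ ε : ℝ, 0 < ε ∧ ∃ C : ℝ, 0 < C ∧ ∃ e : Fin 3 → E2 d,
      LinearIndependent ℝ e ∧ (∀ j : Fin d, e 2 (Sum.inl j) = 0) ∧
      ∀ k : Fin 3, ∀ v : E2 d, ∀ h ∈ Set.Ioc (0:ℝ) h₀,
        volume {s : ℝ | ‖s • e k + v - vbar‖ < ε ∧
            ‖gradient (symb a) (s • e k + v)‖ ≤ Cb * h ^ δ₀}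
          ≤ ENNReal.ofReal (C * h ^ (![δ₀, δ₀, δ₀ / (2 * (m₀:ℝ) - 1)] k)) := by
  classical
  have hf := contDiff_symb a hreg
  set f := symb a with hfdef
  have hf1 : Differentiable ℝ f := hf.differentiable (by norm_num)
  have hf2 : ContDiff ℝ 1 (fderiv ℝ f) := hf.fderiv_right (by norm_num)
  have hf2d : Differentiable ℝ (fderiv ℝ f) := hf2.differentiable (by norm_num)
  have hf3 : Continuous (fderiv ℝ (fderiv ℝ f)) := hf2.continuous_fderiv (by norm_num)
  set B := fderiv ℝ (fderiv ℝ f) vbar with hB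
  have hB0 : B ≠ 0 := by
    intro h0
    have : hess f vbar = 0 := by
      ext i j
      have : fderiv ℝ (fun x => fderiv ℝ f x (EuclideanSpace.single j 1)) vbar
          = B.flip (EuclideanSpace.single j 1) := by
        rw [fderiv_clm_apply (hf2d _) (differentiableAt_const _)]
        simp [hB]
      change fderiv ℝ (fun x => fderiv ℝ f x (EuclideanSpace.single j 1)) vbar
        (EuclideanSpace.single i 1) = (0 : ℝ)
      rw [this, h0]; simp
    rw [this] at hrank
    simp at hrank
  let j0 : Fin d := ⟨0, by omega⟩
  let e3 : E2 d := EuclideanSpace.single (Sum.inr j0) 1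
  have he3 : e3 ≠ 0 := by simp [e3]
  have hker : B.ker ≠ ⊤ := by
    intro h
    apply hB0
    ext x : 1
    have : x ∈ B.ker := by rw [h]; trivial
    simpa using this
  have hdim : Module.finrank ℝ (E2 d) = 2 * d := by
    rw [finrank_euclideanSpace]; simp; ring
  have hspan : ∀ s : Finset (E2 d), s.card ≤ 2 → Submodule.span ℝ (s : Set (E2 d)) ≠ ⊤ := by
    intro s hs h
    have := finrank_span_finset_le_card (R := ℝ) s
    rw [Set.finrank, h, finrank_top, hdim] at this
    omega
  obtain ⟨e1, he1, he1'⟩ := exists_notMem_two B.ker (Submodule.span ℝ {e3}) hker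
    (by simpa using hspan {e3} (by simp))
  obtain ⟨e2, he2, he2'⟩ := exists_notMem_two B.ker (Submodule.span ℝ {e1, e3}) hker
    (by simpa using hspan {e1, e3} Finset.card_le_two)
  have hind : LinearIndependent ℝ ![e2, e1, e3] := by
    refine linearIndependent_finCons.2 ⟨linearIndependent_finCons.2 ⟨?_, ?_⟩, ?_⟩
    · simpa [linearIndependent_unique_iff] using he3
    · simpa using he1'
    · simpa [Set.pair_comm] using he2'
  have trans : ∀ e : E2 d, e ∉ B.ker → ∃ ε : ℝ, 0 < ε ∧ ∃ C : ℝ, 0 < C ∧ ∀ v : E2 d,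
      ∀ h ∈ Set.Ioc (0:ℝ) h₀, ∀ ε' ≤ ε, ∀ C' ≥ C,
        volume {s : ℝ | ‖s • e + v - vbar‖ < ε' ∧ ‖gradient f (s • e + v)‖ ≤ Cb * h ^ δ₀}
          ≤ ENNReal.ofReal (C' * h ^ δ₀) := by
    intro e he
    obtain ⟨w, hw⟩ : ∃ w, 0 < B e w := by
      have : B e ≠ 0 := by simpa using he
      obtain ⟨w, hw⟩ : ∃ w, B e w ≠ 0 := by
        by_contra h; push Not at h; exact this (by ext w; simpa using h w)
      rcases lt_or_gt_of_ne hw with h | h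
      · exact ⟨-w, by simpa using h⟩
      · exact ⟨w, h⟩
    set κ := B e w / 2 with hκ
    have hκ0 : 0 < κ := by positivity
    have hcont : Continuous fun u => fderiv ℝ (fderiv ℝ f) u e w := by fun_prop
    obtain ⟨ε, hε, hball⟩ := Metric.mem_nhds_iff.1
      ((hcont.tendsto vbar).eventually (lt_mem_nhds
        (show κ < fderiv ℝ (fderiv ℝ f) vbar e w by rw [← hB]; linarith)))
    refine ⟨ε, hε, 2 * (Cb * ‖w‖) / κ + 1, by positivity, ?_⟩
    intro v h hh ε' hε' C' hC'
    have hline : ∀ s : ℝ, HasDerivAt (fun s : ℝ => s • e + v) e s := fun s => by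
      simpa using ((hasDerivAt_id s).smul_const e).add_const v
    have hg : ∀ s : ℝ, HasDerivAt (fun s : ℝ => fderiv ℝ f (s • e + v) w)
        (fderiv ℝ (fderiv ℝ f) (s • e + v) e w) s := fun s => by
      have h1 := (hf2d (s • e + v)).hasFDerivAt.comp_hasDerivAt s (hline s)
      have h2 := h1.clm_apply (hasDerivAt_const s w)
      simpa using h2
    have hconv : Convex ℝ {s : ℝ | ‖s • e + v - vbar‖ < ε} := by
      intro s hs t ht α β hα hβ hαβ
      have h1 : (α • s + β • t) • e + v ∈ Metric.ball vbar ε := by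
        have h2 := convex_ball vbar ε (x := s • e + v) (by simpa [dist_eq_norm] using hs)
          (y := t • e + v) (by simpa [dist_eq_norm] using ht) hα hβ hαβ
        convert h2 using 1
        have : v = (α + β) • v := by rw [hαβ, one_smul]
        conv_lhs => rw [this]
        simp only [smul_eq_mul]
        module
      simpa [dist_eq_norm] using h1
    have hmain := mono_sublevel _ _ hg _ hconv κ (‖w‖ * (Cb * h ^ δ₀)) hκ0 (fun s hs => by
      have : s • e + v ∈ Metric.ball vbar ε := by simpa [dist_eq_norm] using hs
      have h5 : κ < fderiv ℝ (fderiv ℝ f) (s • e + v) e w := hball this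
      exact h5.le)
    refine (measure_mono ?_).trans (hmain.trans (ENNReal.ofReal_le_ofReal ?_))
    · rintro s ⟨hs1, hs2⟩
      refine ⟨lt_of_lt_of_le hs1 hε', ?_⟩
      rw [norm_gradient_eq] at hs2
      have := (fderiv ℝ f (s • e + v)).le_opNorm w
      rw [Real.norm_eq_abs] at this
      refine this.trans ?_
      rw [mul_comm]
      gcongr
    · have hp : 0 < h ^ δ₀ := Real.rpow_pos_of_pos hh.1 _
      have : 2 * (‖w‖ * (Cb * h ^ δ₀)) / κ = 2 * (Cb * ‖w‖) / κ * h ^ δ₀ := by ring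
      rw [this]
      gcongr
      linarith
  obtain ⟨ε1, hε1, C1, hC1, H1⟩ := trans e1 he1
  obtain ⟨ε2, hε2, C2, hC2, H2⟩ := trans e2 he2
  obtain ⟨c₀, hc₀, hell⟩ := hell
  let η : EuclideanSpace ℝ (Fin d) := EuclideanSpace.single j0 1
  have hvert : ∃ C : ℝ, 0 < C ∧ ∀ v : E2 d, ∀ h ∈ Set.Ioc (0:ℝ) h₀,
        volume {s : ℝ | ‖gradient f (s • e3 + v)‖ ≤ Cb * h ^ δ₀}
          ≤ ENNReal.ofReal (C * h ^ (δ₀ / (2 * (m₀:ℝ) - 1))) := by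
    have hn : ((2 * m₀ - 1 : ℕ) : ℝ) = 2 * (m₀:ℝ) - 1 := by
      rw [Nat.cast_sub (by omega)]; push_cast; ring
    have hnpos : (0:ℝ) < 2 * (m₀:ℝ) - 1 := by
      have : (1:ℝ) ≤ m₀ := by exact_mod_cast hm
      linarith
    refine ⟨2 * (2 * (m₀:ℝ) - 1) * (Cb / c₀) ^ ((1:ℝ) / (2 * (m₀:ℝ) - 1)), by positivity, ?_⟩
    intro v h hh
    set P := linePoly a (xpart v) (fun j => v (Sum.inr j)) η with hP
    have hev : ∀ s : ℝ, P.eval s = f (s • e3 + v) := by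
      intro s
      have hx : xpart (s • e3 + v) = xpart v := by
        unfold xpart; congr 1; ext j; simp [e3]
      rw [hP, linePoly, hfdef, symb, hx]
      simp only [Polynomial.eval_finsetSum, Polynomial.eval_mul, Polynomial.eval_C,
        Polynomial.eval_prod, Polynomial.eval_pow, Polynomial.eval_add, Polynomial.eval_X]
      refine Finset.sum_congr rfl fun ν _ => Finset.sum_congr rfl fun ν' _ => ?_
      congr 1
      refine Finset.prod_congr rfl fun j _ => ?_
      congr 1
      simp [e3, η, mul_comm]
    have hder : ∀ s : ℝ, P.derivative.eval s = fderiv ℝ f (s • e3 + v) e3 := by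
      intro s
      have hline : HasDerivAt (fun s : ℝ => s • e3 + v) e3 s := by
        simpa using ((hasDerivAt_id s).smul_const e3).add_const v
      have h1 := (hf1 (s • e3 + v)).hasFDerivAt.comp_hasDerivAt s hline
      have h2 : HasDerivAt (fun s => P.eval s) (fderiv ℝ f (s • e3 + v) e3) s := by
        simp_rw [hev]; exact h1
      exact (P.hasDerivAt s).unique h2
    have hdeg : P.derivative.natDegree ≤ 2 * m₀ - 1 := by
      refine (Polynomial.natDegree_derivative_le P).trans ?_
      have := linePoly_natDegree a (xpart v) (fun j => v (Sum.inr j)) η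
      rw [← hP] at this
      omega
    have hcoef : c₀ ≤ P.derivative.coeff (2 * m₀ - 1) := by
      rw [Polynomial.coeff_derivative, Nat.sub_add_cancel (by omega), hn]
      have h1 := hell (xpart v) η
      rw [← linePoly_coeff a (xpart v) (fun j => v (Sum.inr j)) η] at h1
      have h2 : ‖η‖ = 1 := by simp [η]
      rw [h2, one_pow, mul_one] at h1
      have : (1:ℝ) ≤ m₀ := by exact_mod_cast hm
      have h3 : c₀ ≤ P.coeff (2 * m₀) := h1
      nlinarith
    have hp : 0 < h ^ δ₀ := Real.rpow_pos_of_pos hh.1 _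
    have hmain := poly_sublevel P.derivative (2 * m₀ - 1) (by omega) hdeg c₀ (Cb * h ^ δ₀) hc₀
      (by positivity) hcoef
    refine (measure_mono ?_).trans (hmain.trans (ENNReal.ofReal_le_ofReal (le_of_eq ?_)))
    · intro s hs
      simp only [Set.mem_ofPred_eq] at hs ⊢
      rw [norm_gradient_eq] at hs
      have := (fderiv ℝ f (s • e3 + v)).le_opNorm e3
      have h3 : ‖e3‖ = 1 := by simp [e3]
      rw [Real.norm_eq_abs, h3, mul_one, ← hder] at this
      exact this.trans hs
    · rw [hn, mul_div_right_comm, Real.mul_rpow (by positivity) hp.le, ← Real.rpow_mul hh.1.le,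
        mul_one_div]
      ring
  obtain ⟨C3, hC3, H3⟩ := hvert
  refine ⟨min ε1 ε2, lt_min hε1 hε2, max (max C1 C2) C3, by positivity, ![e2, e1, e3], hind,
    fun j => by simp [e3], ?_⟩
  intro k v h hh
  fin_cases k
  · exact H2 v h hh _ (min_le_right _ _) _ ((le_max_right _ _).trans (le_max_left _ _))
  · exact H1 v h hh _ (min_le_left _ _) _ ((le_max_left _ _).trans (le_max_left _ _))
  · refine (measure_mono ?_).trans ((H3 v h hh).trans (ENNReal.ofReal_le_ofReal ?_))
    · rintro s ⟨_, hs⟩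
      exact hs
    · have : 0 ≤ h ^ (δ₀ / (2 * (m₀:ℝ) - 1)) := Real.rpow_nonneg hh.1.le _
      exact mul_le_mul_of_nonneg_right (le_max_right _ _) this

end
end
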